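/- There exist a constant C and a real number x₀ such that for every real x ≥ x₀, every real w with 1 ≤ w ≤ x/10, and every completely multiplicative function f with -1 ≤ f(n) ≤ 1 for all positive integers n, one has | F(x) − F(x/w) | ≤ C (log 2w / log x)^{1/4}, where F(t) = (1/t) ∑_{n ≤ t} f(n). -/

import Mathlib

/-- A completely multiplicative function `f : ℕ → ℝ` (on positive integers):
`f 1 = 1` and `f (m * n) = f m * f n` for all positive `m, n`. -/
def IsComplMult (f : ℕ → ℝ) : Prop :=
  f 1 = 1 ∧ ∀ m n : ℕ, 0 < m → 0 < n → f (m * n) = f m * f n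

/-- The mean value `F t = (1/t) ∑_{n ≤ t} f n`. -/
noncomputable def meanValue (f : ℕ → ℝ) (t : ℝ) : ℝ :=
  (1 / t) * ∑ n ∈ Finset.Icc 1 ⌊t⌋₊, f n

section

open MeasureTheory FourierTransform Real

/-- The `L²` Fourier transform of an integrable function is the integral one. -/
theorem Lp_fourier_ae_eq {h : ℝ → ℂ} (h1 : Integrable h) (h2 : MemLp h 2) :
    (𝓕 (h2.toLp h) : Lp ℂ 2 (volume : Measure ℝ)) =ᵐ[volume] 𝓕 h := by
  have hcont : Continuous (𝓕 h) :=
    VectorFourier.fourierIntegral_continuous Real.continuous_fourierChar continuous_inner h1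
  refine ae_eq_of_integral_contDiff_smul_eq
    ((Lp.memLp _).locallyIntegrable (by norm_num)) hcont.locallyIntegrable ?_
  intro g hg1 hg2
  have hgc : HasCompactSupport (fun x => (g x : ℂ)) := hg2.comp_left (g := fun x : ℝ => (x : ℂ)) rfl
  have hgd : ContDiff ℝ (⊤ : ℕ∞) (fun x => (g x : ℂ)) := Complex.ofRealCLM.contDiff.comp hg1
  set G : SchwartzMap ℝ ℂ := hgc.toSchwartzMap hgd with hG
  have hGx : ∀ x, G x = (g x : ℂ) := fun x => rfl
  have key := congrArg (fun T => T G) (Lp.fourier_toTemperedDistribution_eq (h2.toLp h))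
  simp only [TemperedDistribution.fourier_apply, Lp.toTemperedDistribution_apply] at key
  have e1 : ∫ x, g x • (𝓕 (h2.toLp h) : Lp ℂ 2 (volume : Measure ℝ)) x =
      ∫ x, G x • (𝓕 (h2.toLp h) : Lp ℂ 2 (volume : Measure ℝ)) x := by
    simp [hGx]
  rw [e1, ← key]
  have e2 : ∫ x, g x • 𝓕 h x = ∫ x, G x • 𝓕 h x := by simp [hGx]
  rw [e2]
  have flip := VectorFourier.integral_fourierIntegral_smul_eq_flip (μ := volume) (ν := volume)
    (L := innerₗ ℝ) (e := Real.fourierChar) (f := (G : ℝ → ℂ)) (g := h)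
    Real.continuous_fourierChar continuous_inner G.integrable h1
  rw [flip_innerₗ] at flip
  refine Eq.trans ?_ flip
  refine integral_congr_ae ?_
  filter_upwards [h2.coeFn_toLp] with x hx
  rw [hx]
  rfl

theorem eLpNorm_fourier {h : ℝ → ℂ} (h1 : Integrable h) (h2 : MemLp h 2) :
    eLpNorm (𝓕 h) 2 volume = eLpNorm h 2 volume := by
  rw [← eLpNorm_congr_ae (Lp_fourier_ae_eq h1 h2), ← eLpNorm_congr_ae h2.coeFn_toLp]
  have := Lp.norm_fourier_eq (h2.toLp h)
  rw [Lp.norm_def, Lp.norm_def] at this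
  exact (ENNReal.toReal_eq_toReal_iff' (Lp.eLpNorm_ne_top _) (Lp.eLpNorm_ne_top _)).1 this

/-- Plancherel's identity for functions in `L¹ ∩ L²`. -/
theorem lintegral_fourier_sq {h : ℝ → ℂ} (h1 : Integrable h) (h2 : MemLp h 2) :
    ∫⁻ x, ‖𝓕 h x‖ₑ ^ 2 = ∫⁻ x, ‖h x‖ₑ ^ 2 := by
  have h3 := eLpNorm_fourier h1 h2
  rw [eLpNorm_eq_lintegral_rpow_enorm_toReal (by norm_num) (by norm_num),
    eLpNorm_eq_lintegral_rpow_enorm_toReal (by norm_num) (by norm_num)] at h3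
  have h4 := ENNReal.rpow_left_injective (x := 1 / (2 : ENNReal).toReal) (by norm_num) h3
  simpa using h4

end

theorem four_mul_re_neg_log_le {c r : ℝ} (hc : |c| ≤ 1) (hr0 : 0 ≤ r) (hr : r < 1) {u : ℂ}
    (hu : ‖u‖ = 1) :
    4 * (-Complex.log (1 - c * (r * u))).re ≤
      3 * (-Complex.log (1 - (r : ℂ))).re + (-Complex.log (1 - r * u ^ 2)).re := by
  have n1 : ‖(c : ℂ) * (r * u)‖ < 1 := by
    simp only [norm_mul, Complex.norm_real, hu, Real.norm_eq_abs, abs_of_nonneg hr0, mul_one]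
    nlinarith [abs_nonneg c]
  have n2 : ‖(r : ℂ)‖ < 1 := by simpa [abs_of_nonneg hr0]
  have n3 : ‖(r : ℂ) * u ^ 2‖ < 1 := by simpa [abs_of_nonneg hr0, hu]
  have s1 := (Complex.hasSum_re (Complex.hasSum_taylorSeries_neg_log n1)).mul_left 4
  have s2 := (Complex.hasSum_re (Complex.hasSum_taylorSeries_neg_log n2)).mul_left 3
  have s3 := Complex.hasSum_re (Complex.hasSum_taylorSeries_neg_log n3)
  refine hasSum_le (fun n => ?_) s1 (s2.add s3)
  have e1 : (((c : ℂ) * (r * u)) ^ n / n).re = c ^ n * r ^ n * (u ^ n).re / n := by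
    rw [mul_pow, mul_pow, ← Complex.ofReal_pow, ← Complex.ofReal_pow, ← mul_assoc,
      ← Complex.ofReal_mul, ← Complex.ofReal_natCast, Complex.div_ofReal_re, Complex.re_ofReal_mul]
  have e2 : ((r : ℂ) ^ n / n).re = r ^ n / n := by
    rw [← Complex.ofReal_pow, ← Complex.ofReal_natCast, Complex.div_ofReal_re, Complex.ofReal_re]
  have e3 : (((r : ℂ) * u ^ 2) ^ n / n).re = r ^ n * (2 * (u ^ n).re ^ 2 - 1) / n := by
    rw [mul_pow, ← Complex.ofReal_pow, ← Complex.ofReal_natCast, Complex.div_ofReal_re,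
      Complex.re_ofReal_mul, ← pow_mul, mul_comm 2 n, pow_mul, sq (u ^ n), Complex.mul_re]
    have h : ‖u ^ n‖ ^ 2 = 1 := by simp [hu]
    rw [Complex.sq_norm, Complex.normSq_apply] at h
    congr 2
    nlinarith
  rw [e1, e2, e3]
  have hcn : |c ^ n| ≤ 1 := by rw [abs_pow]; exact pow_le_one₀ (abs_nonneg _) hc
  have hrn : 0 ≤ r ^ n := pow_nonneg hr0 n
  have key : 4 * (c ^ n * (u ^ n).re) ≤ 3 + (2 * (u ^ n).re ^ 2 - 1) := by
    have := abs_le.1 hcn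
    have h5 : c ^ n * (u ^ n).re ≤ |(u ^ n).re| := by
      refine (le_abs_self _).trans ?_
      rw [abs_mul]
      exact mul_le_of_le_one_left (abs_nonneg _) hcn
    nlinarith [sq_nonneg (|(u ^ n).re| - 1), sq_abs (u ^ n).re]
  have hn : (0 : ℝ) ≤ n := Nat.cast_nonneg n
  calc 4 * (c ^ n * r ^ n * (u ^ n).re / n) = r ^ n * (4 * (c ^ n * (u ^ n).re)) / n := by ring
    _ ≤ r ^ n * (3 + (2 * (u ^ n).re ^ 2 - 1)) / n := by gcongr
    _ = _ := by ring

/-- The terms of the Dirichlet series of a completely multiplicative function. -/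
noncomputable def termHom {f : ℕ → ℝ} (hf : IsComplMult f) (s : ℂ) : ℕ →*₀ ℂ where
  toFun n := LSeries.term (fun n => (f n : ℂ)) s n
  map_zero' := LSeries.term_zero ..
  map_one' := by simp [hf.1]
  map_mul' m n := by
    rcases eq_or_ne m 0 with rfl | hm
    · simp
    rcases eq_or_ne n 0 with rfl | hn
    · simp
    rw [LSeries.term_of_ne_zero (mul_ne_zero hm hn), LSeries.term_of_ne_zero hm,
      LSeries.term_of_ne_zero hn, hf.2 m n (Nat.pos_of_ne_zero hm) (Nat.pos_of_ne_zero hn)]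
    push_cast
    rw [Complex.natCast_mul_natCast_cpow]
    field_simp

theorem termHom_apply {f : ℕ → ℝ} (hf : IsComplMult f) (s : ℂ) (n : ℕ) :
    termHom hf s n = LSeries.term (fun n => (f n : ℂ)) s n := rfl

theorem LSeriesSummable_of_abs_le_one {f : ℕ → ℝ} (hb : ∀ n : ℕ, 0 < n → |f n| ≤ 1) {s : ℂ}
    (hs : 1 < s.re) : LSeriesSummable (fun n => (f n : ℂ)) s :=
  LSeriesSummable_of_bounded_of_one_lt_re (m := 1)
    (fun n hn => by simpa using hb n (Nat.pos_of_ne_zero hn)) hs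

theorem isComplMult_one : IsComplMult (fun _ => 1) := ⟨rfl, by simp⟩

theorem norm_LSeries_eq_exp_tsum {f : ℕ → ℝ} (hf : IsComplMult f)
    (hb : ∀ n : ℕ, 0 < n → |f n| ≤ 1) {s : ℂ} (hs : 1 < s.re) :
    Summable (fun p : Nat.Primes => (-Complex.log (1 - termHom hf s p)).re) ∧
    ‖LSeries (fun n => (f n : ℂ)) s‖ =
      Real.exp (∑' p : Nat.Primes, (-Complex.log (1 - termHom hf s p)).re) := by
  have hsum : Summable fun n => ‖termHom hf s n‖ := (LSeriesSummable_of_abs_le_one hb hs).norm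
  have h2 : Summable fun p : Nat.Primes => -Complex.log (1 - termHom hf s p) :=
    (hsum.of_norm.subtype {p | p.Prime}).clog_one_sub.neg
  refine ⟨Complex.reCLM.summable h2, ?_⟩
  have h1 := EulerProduct.exp_tsum_primes_log_eq_tsum hsum
  have h3 : LSeries (fun n => (f n : ℂ)) s = ∑' n, termHom hf s n := rfl
  rw [h3, ← h1, Complex.norm_exp]
  congr 1
  exact Complex.re_tsum h2

theorem norm_LSeries_pow_four_le {f : ℕ → ℝ} (hf : IsComplMult f)
    (hb : ∀ n : ℕ, 0 < n → |f n| ≤ 1) {σ : ℝ} (hσ : 1 < σ) (y : ℝ) :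
    ‖LSeries (fun n => (f n : ℂ)) (σ + y * Complex.I)‖ ^ 4 ≤
      ‖LSeries 1 (σ : ℂ)‖ ^ 3 * ‖LSeries 1 (σ + 2 * y * Complex.I)‖ := by
  have b1 : ∀ n : ℕ, 0 < n → |(fun _ => 1 : ℕ → ℝ) n| ≤ 1 := by simp
  obtain ⟨s1, h1⟩ := norm_LSeries_eq_exp_tsum hf hb (s := σ + y * Complex.I) (by simpa)
  obtain ⟨s2, h2⟩ := norm_LSeries_eq_exp_tsum isComplMult_one b1 (s := σ) (by simpa)
  obtain ⟨s3, h3⟩ := norm_LSeries_eq_exp_tsum isComplMult_one b1 (s := σ + 2 * y * Complex.I)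
    (by simpa)
  have hone : (fun n : ℕ => (((fun _ => 1 : ℕ → ℝ) n : ℝ) : ℂ)) = 1 := by ext; simp
  rw [hone] at h2 h3
  rw [h1, h2, h3, ← Real.exp_nat_mul, ← Real.exp_nat_mul, ← Real.exp_add, Real.exp_le_exp,
    ← tsum_mul_left, ← tsum_mul_left, ← Summable.tsum_add (s2.mul_left _) s3]
  refine Summable.tsum_le_tsum (fun p => ?_) (s1.mul_left _) ((s2.mul_left _).add s3)
  have hp : (p : ℕ) ≠ 0 := p.2.ne_zero
  have hp0 : ((p : ℕ) : ℂ) ≠ 0 := by exact_mod_cast hp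
  have hpp : (0 : ℝ) < (p : ℕ) := by exact_mod_cast p.2.pos
  set u : ℂ := ((p : ℕ) : ℂ) ^ (-(y * Complex.I)) with hu
  have hun : ‖u‖ = 1 := by
    rw [hu, Complex.norm_natCast_cpow_of_pos p.2.pos]; simp
  have hr1 : ((p : ℕ) : ℝ) ^ (-σ) < 1 :=
    Real.rpow_lt_one_of_one_lt_of_neg (by exact_mod_cast p.2.one_lt) (by linarith)
  have key := four_mul_re_neg_log_le (hb p p.2.pos) (Real.rpow_nonneg hpp.le (-σ)) hr1 hun
  have hrc : (((((p : ℕ) : ℝ) ^ (-σ)) : ℝ) : ℂ) = ((p : ℕ) : ℂ) ^ (-(σ : ℂ)) := by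
    rw [Complex.ofReal_cpow hpp.le]; simp
  have t1 : termHom hf (σ + y * Complex.I) p
      = (f p : ℂ) * (((((p : ℕ) : ℝ) ^ (-σ)) : ℝ) * u) := by
    rw [termHom_apply, LSeries.term_of_ne_zero hp, hrc, hu, ← Complex.cpow_add _ _ hp0, ← neg_add,
      Complex.cpow_neg, div_eq_mul_inv]
  have t2 : termHom isComplMult_one σ p = (((((p : ℕ) : ℝ) ^ (-σ)) : ℝ) : ℂ) := by
    rw [termHom_apply, LSeries.term_of_ne_zero hp, hrc, Complex.cpow_neg]; simp
  have t3 : termHom isComplMult_one (σ + 2 * y * Complex.I) p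
      = (((((p : ℕ) : ℝ) ^ (-σ)) : ℝ) : ℂ) * u ^ 2 := by
    rw [termHom_apply, LSeries.term_of_ne_zero hp, hrc, hu, sq, ← Complex.cpow_add _ _ hp0,
      ← Complex.cpow_add _ _ hp0,
      show -(σ : ℂ) + (-(y * Complex.I) + -(y * Complex.I)) = -(σ + 2 * y * Complex.I) by ring,
      Complex.cpow_neg]
    simp
  rw [t1, t2, t3]
  exact_mod_cast key

section

open MeasureTheory Set

theorem norm_LSeries_one_le {s : ℂ} (hs : 1 < s.re) :
    ‖LSeries 1 s‖ ≤ ‖s‖ * (1 / ‖s - 1‖ + 1) := by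
  have hsum : ∀ n : ℕ, ∑ k ∈ Finset.Icc 1 n, (1 : ℕ → ℂ) k = n := by intro n; simp
  have hO : (fun n : ℕ => ∑ k ∈ Finset.Icc 1 n, ‖(1 : ℕ → ℂ) k‖) =O[Filter.atTop]
      fun n : ℕ => (n : ℝ) ^ (1 : ℝ) := by
    simp only [Pi.one_apply, norm_one, Finset.sum_const, Nat.card_Icc, Real.rpow_one]
    simpa using Asymptotics.isBigO_refl _ _
  rw [LSeries_eq_mul_integral' 1 zero_le_one hs hO, norm_mul]
  gcongr
  simp only [hsum]
  have h1 : ∫ t in Ioi (1 : ℝ), (t : ℂ) ^ (-s) = 1 / (s - 1) := by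
    rw [integral_Ioi_cpow_of_lt (by simpa using hs) one_pos]
    simp only [Complex.ofReal_one, Complex.one_cpow]
    rw [show -s + 1 = -(s - 1) by ring, neg_div_neg_eq]
  have i1 : IntegrableOn (fun t : ℝ => (t : ℂ) ^ (-s)) (Ioi 1) :=
    integrableOn_Ioi_cpow_of_lt (by simpa using hs) one_pos
  have hb : ∀ t ∈ Ioi (1 : ℝ), ‖((⌊t⌋₊ : ℂ) - t) * (t : ℂ) ^ (-(s + 1))‖ ≤ t ^ (-(1 + 1 : ℝ)) := by
    intro t ht
    have ht0 : (0 : ℝ) < t := one_pos.trans ht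
    rw [norm_mul, Complex.norm_cpow_eq_rpow_re_of_pos ht0]
    have e1 : ‖(⌊t⌋₊ : ℂ) - t‖ ≤ 1 := by
      rw [show (⌊t⌋₊ : ℂ) - t = (((⌊t⌋₊ : ℝ) - t : ℝ) : ℂ) by push_cast; rfl, Complex.norm_real,
        Real.norm_eq_abs, abs_le]
      constructor <;> linarith [Nat.floor_le ht0.le, Nat.lt_floor_add_one t]
    have e2 : t ^ (-(s + 1)).re ≤ t ^ (-(1 + 1 : ℝ)) := by
      apply Real.rpow_le_rpow_of_exponent_le (le_of_lt ht)
      simp; linarith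
    calc _ ≤ 1 * t ^ (-(1 + 1 : ℝ)) := mul_le_mul e1 e2 (by positivity) zero_le_one
      _ = _ := one_mul _
  have i0 : IntegrableOn (fun t : ℝ => t ^ (-(1 + 1 : ℝ))) (Ioi 1) :=
    integrableOn_Ioi_rpow_of_lt (by norm_num) one_pos
  have i2 : IntegrableOn (fun t : ℝ => ((⌊t⌋₊ : ℂ) - t) * (t : ℂ) ^ (-(s + 1))) (Ioi 1) := by
    refine Integrable.mono' i0 ?_ ((ae_restrict_iff' measurableSet_Ioi).2 (.of_forall hb))
    exact Measurable.aestronglyMeasurable (by fun_prop)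
  have e : ∫ t in Ioi (1 : ℝ), (⌊t⌋₊ : ℂ) * (t : ℂ) ^ (-(s + 1)) =
      1 / (s - 1) + ∫ t in Ioi (1 : ℝ), ((⌊t⌋₊ : ℂ) - t) * (t : ℂ) ^ (-(s + 1)) := by
    rw [← h1, ← integral_add i1 i2]
    refine setIntegral_congr_fun measurableSet_Ioi fun t ht => ?_
    have ht0 : (t : ℂ) ≠ 0 := by exact_mod_cast (one_pos.trans ht).ne'
    have : (t : ℂ) ^ (-s) = t * (t : ℂ) ^ (-(s + 1)) := by
      rw [show -s = 1 + -(s + 1) by ring, Complex.cpow_add _ _ ht0, Complex.cpow_one]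
    simp only [this]; ring
  rw [e]
  refine (norm_add_le _ _).trans (add_le_add (by simp) ?_)
  refine (norm_integral_le_of_norm_le i0
    ((ae_restrict_iff' measurableSet_Ioi).2 (.of_forall hb))).trans ?_
  rw [integral_Ioi_rpow_of_lt (by norm_num) one_pos]
  norm_num

theorem norm_one_sub_cpow_neg_le {w : ℝ} (hw : 1 ≤ w) {z : ℂ} (hz : 0 ≤ z.re) :
    ‖1 - (w : ℂ) ^ (-z)‖ ≤ 2 ∧ ‖1 - (w : ℂ) ^ (-z)‖ ≤ 2 * (‖z‖ * Real.log w) := by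
  have hw0 : 0 < w := by linarith
  have h2 : ‖1 - (w : ℂ) ^ (-z)‖ ≤ 2 := by
    refine (norm_sub_le _ _).trans ?_
    rw [Complex.norm_cpow_eq_rpow_re_of_pos hw0]
    have : w ^ (-z).re ≤ 1 := Real.rpow_le_one_of_one_le_of_nonpos hw (by simpa)
    simp only [norm_one]; linarith
  refine ⟨h2, ?_⟩
  have hl : 0 ≤ Real.log w := Real.log_nonneg hw
  rcases le_total (‖z‖ * Real.log w) 1 with h | h
  · rw [Complex.cpow_def_of_ne_zero (by exact_mod_cast hw0.ne'), norm_sub_rev]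
    have hn : ‖Complex.log w * -z‖ = ‖z‖ * Real.log w := by
      rw [← Complex.ofReal_log hw0.le, norm_mul, norm_neg, Complex.norm_real, Real.norm_eq_abs,
        abs_of_nonneg hl, mul_comm]
    rw [← hn]
    exact Complex.norm_exp_sub_one_le (hn.trans_le h)
  · linarith

theorem one_add_log_le {w : ℝ} (hw : 1 ≤ w) : 1 + Real.log w ≤ 2 * Real.log (2 * w) := by
  rw [Real.log_mul two_ne_zero (by linarith)]
  linarith [Real.log_two_gt_d9, Real.log_nonneg hw]

theorem norm_LSeries_mul_pow_four_le {f : ℕ → ℝ} (hf : IsComplMult f)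
    (hb : ∀ n : ℕ, 0 < n → |f n| ≤ 1) {α : ℝ} (hα : 0 < α) (hα2 : α ≤ 2) (y : ℝ) {w : ℝ}
    (hw : 1 ≤ w) :
    ‖LSeries (fun n => (f n : ℂ)) (1 + α + y * Complex.I) *
      (1 - (w : ℂ) ^ (-(α + y * Complex.I : ℂ)))‖ ^ 4 ≤
      46656 * Real.log (2 * w) * ‖(1 + α + y * Complex.I : ℂ)‖ / α ^ 3 := by
  have h1 := norm_LSeries_pow_four_le hf hb (σ := 1 + α) (by linarith) y
  push_cast at h1
  set s : ℂ := 1 + α + y * Complex.I with hs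
  set z : ℂ := α + y * Complex.I with hz
  have hzre : z.re = α := by simp [hz]
  have hzpos : 0 < ‖z‖ := by
    refine norm_pos_iff.2 fun h => ?_
    rw [h] at hzre; simp at hzre; linarith
  obtain ⟨g1, g2⟩ := norm_one_sub_cpow_neg_le hw (z := z) (by linarith)
  have hσ : ‖LSeries 1 (1 + α : ℂ)‖ ≤ 9 / α := by
    have := norm_LSeries_one_le (s := 1 + α) (by simpa)
    have e1 : ‖(1 + α : ℂ)‖ = 1 + α := by
      rw [show (1 + α : ℂ) = ((1 + α : ℝ) : ℂ) by push_cast; rfl, Complex.norm_real,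
        Real.norm_eq_abs, abs_of_pos (by linarith)]
    rw [e1, add_sub_cancel_left, Complex.norm_real, Real.norm_eq_abs, abs_of_pos hα] at this
    refine this.trans ?_
    rw [le_div_iff₀ hα]
    field_simp
    nlinarith
  have hτ : ‖LSeries 1 (1 + α + 2 * y * Complex.I : ℂ)‖ ≤ 2 * ‖s‖ * (1 / ‖z‖ + 1) := by
    refine (norm_LSeries_one_le (by simpa)).trans ?_
    have n1 : ‖(1 + α + 2 * y * Complex.I : ℂ)‖ ≤ 2 * ‖s‖ := by
      rw [show (1 + α + 2 * y * Complex.I : ℂ) = 2 * s - ((1 + α : ℝ) : ℂ) by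
        rw [hs]; push_cast; ring]
      have e0 : (1 + α + 2 * y * Complex.I : ℂ) = 2 * s - ((1 + α : ℝ) : ℂ) := by
        rw [hs]; push_cast; ring
      rw [← e0]
      refine le_of_sq_le_sq ?_ (by positivity)
      rw [mul_pow, Complex.sq_norm, Complex.sq_norm, Complex.normSq_apply, Complex.normSq_apply]
      simp [hs]
      nlinarith [sq_nonneg (1 + α)]
    have n2 : ‖z‖ ≤ ‖(1 + α + 2 * y * Complex.I : ℂ) - 1‖ := by
      refine le_of_sq_le_sq ?_ (by positivity)
      rw [Complex.sq_norm, Complex.sq_norm, Complex.normSq_apply, Complex.normSq_apply]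
      simp [hz]
      nlinarith [sq_nonneg y]
    gcongr
  have hl := one_add_log_le hw
  have hlw : 0 ≤ Real.log w := Real.log_nonneg hw
  set q := ‖1 - (w : ℂ) ^ (-z)‖ with hq
  have hq0 : 0 ≤ q := norm_nonneg _
  have hq4 : q ^ 4 * (1 / ‖z‖ + 1) ≤ 32 * Real.log (2 * w) := by
    have a1 : q ^ 4 ≤ 8 * q := by
      have : q ^ 3 ≤ 2 ^ 3 := pow_le_pow_left₀ hq0 g1 3
      nlinarith
    have a2 : q * (1 / ‖z‖) ≤ 2 * Real.log w := by
      rw [mul_one_div, div_le_iff₀ hzpos]; linarith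
    have : 0 ≤ 1 / ‖z‖ := by positivity
    nlinarith
  rw [norm_mul, mul_pow]
  calc _ ≤ (‖LSeries 1 (1 + α : ℂ)‖ ^ 3 * ‖LSeries 1 (1 + α + 2 * y * Complex.I : ℂ)‖) * q ^ 4 := by
        gcongr
    _ ≤ ((9 / α) ^ 3 * (2 * ‖s‖ * (1 / ‖z‖ + 1))) * q ^ 4 := by gcongr
    _ = (9 / α) ^ 3 * (2 * ‖s‖) * (q ^ 4 * (1 / ‖z‖ + 1)) := by ring
    _ ≤ (9 / α) ^ 3 * (2 * ‖s‖) * (32 * Real.log (2 * w)) := by gcongr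
    _ = _ := by ring

end

section

open MeasureTheory Set FourierTransform

/-- The summatory function of `a` in logarithmic scale, damped by `exp (-σ u)`. -/
noncomputable def dampedSum (a : ℕ → ℂ) (σ : ℝ) (u : ℝ) : ℂ :=
  (Real.exp (-σ * u) : ℂ) * ∑ k ∈ Finset.Icc 1 ⌊Real.exp u⌋₊, a k

theorem dampedSum_of_neg (a : ℕ → ℂ) (σ : ℝ) {u : ℝ} (hu : u < 0) : dampedSum a σ u = 0 := by
  have : ⌊Real.exp u⌋₊ = 0 := Nat.floor_eq_zero.2 (by simpa using hu)
  simp [dampedSum, this]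

theorem measurable_dampedSum (a : ℕ → ℂ) (σ : ℝ) : Measurable (dampedSum a σ) := by
  have h1 : Measurable fun u : ℝ => ∑ k ∈ Finset.Icc 1 ⌊Real.exp u⌋₊, a k :=
    (measurable_from_nat (f := fun n => ∑ k ∈ Finset.Icc 1 n, a k)).comp
      (Nat.measurable_floor.comp Real.measurable_exp)
  exact Measurable.mul (by fun_prop) h1

section
variable {a : ℕ → ℂ} {K r σ : ℝ}

theorem norm_dampedSum_le (hr : 0 ≤ r) (hK : 0 ≤ K)
    (ha : ∀ n : ℕ, ∑ k ∈ Finset.Icc 1 n, ‖a k‖ ≤ K * (n : ℝ) ^ r) (u : ℝ) :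
    ‖dampedSum a σ u‖ ≤ (Ici 0).indicator (fun u => K * Real.exp (-(σ - r) * u)) u := by
  rcases lt_or_ge u 0 with hu | hu
  · rw [dampedSum_of_neg _ _ hu, indicator_of_notMem (by simpa using hu), norm_zero]
  · rw [indicator_of_mem (by simpa using hu), dampedSum, norm_mul]
    have h1 : ‖∑ k ∈ Finset.Icc 1 ⌊Real.exp u⌋₊, a k‖ ≤ K * Real.exp u ^ r :=
      (norm_sum_le _ _).trans <| (ha _).trans <| by
        gcongr
        exact Nat.floor_le (Real.exp_pos u).le
    rw [Complex.norm_real, Real.norm_eq_abs, abs_of_pos (Real.exp_pos _)]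
    refine (mul_le_mul_of_nonneg_left h1 (Real.exp_pos _).le).trans (le_of_eq ?_)
    rw [← Real.exp_mul, mul_left_comm, ← Real.exp_add]
    ring_nf

theorem integrable_indicator_exp {b : ℝ} (hb : 0 < b) (K : ℝ) :
    Integrable ((Ici (0 : ℝ)).indicator fun u => K * Real.exp (-b * u)) := by
  rw [integrable_indicator_iff measurableSet_Ici, integrableOn_Ici_iff_integrableOn_Ioi]
  exact (exp_neg_integrableOn_Ioi 0 hb).const_mul K

theorem integrable_dampedSum (hr : 0 ≤ r) (hK : 0 ≤ K) (hσ : r < σ)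
    (ha : ∀ n : ℕ, ∑ k ∈ Finset.Icc 1 n, ‖a k‖ ≤ K * (n : ℝ) ^ r) :
    Integrable (dampedSum a σ) :=
  (integrable_indicator_exp (sub_pos.2 hσ) K).mono' (measurable_dampedSum a σ).aestronglyMeasurable
    (.of_forall (norm_dampedSum_le hr hK ha))

theorem lintegral_dampedSum_sq_le (hr : 0 ≤ r) (hK : 0 ≤ K) (hσ : r < σ)
    (ha : ∀ n : ℕ, ∑ k ∈ Finset.Icc 1 n, ‖a k‖ ≤ K * (n : ℝ) ^ r) :
    ∫⁻ u, ‖dampedSum a σ u‖ₑ ^ 2 ≤ ENNReal.ofReal (K ^ 2 / (2 * (σ - r))) := by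
  have hb : 0 < 2 * (σ - r) := by linarith
  have h1 := integrable_indicator_exp hb (K ^ 2)
  have h2 : ∫ u, (Ici (0 : ℝ)).indicator (fun u => K ^ 2 * Real.exp (-(2 * (σ - r)) * u)) u =
      K ^ 2 / (2 * (σ - r)) := by
    rw [integral_indicator measurableSet_Ici, integral_Ici_eq_integral_Ioi, integral_const_mul,
      integral_exp_mul_Ioi (by linarith) 0]
    field_simp
    simp
  rw [← h2, ofReal_integral_eq_lintegral_ofReal h1
    (.of_forall fun u => indicator_nonneg (fun u _ => by positivity) u)]
  refine lintegral_mono fun u => ?_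
  have h3 := norm_dampedSum_le (σ := σ) hr hK ha u
  rw [← ofReal_norm, ← ENNReal.ofReal_pow (norm_nonneg _)]
  refine ENNReal.ofReal_le_ofReal ((pow_le_pow_left₀ (norm_nonneg _) h3 2).trans (le_of_eq ?_))
  by_cases hu : u ∈ Ici (0 : ℝ)
  · rw [indicator_of_mem hu, indicator_of_mem hu, mul_pow, ← Real.exp_nat_mul]
    push_cast; ring_nf
  · rw [indicator_of_notMem hu, indicator_of_notMem hu]; simp

theorem memLp_dampedSum (hr : 0 ≤ r) (hK : 0 ≤ K) (hσ : r < σ)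
    (ha : ∀ n : ℕ, ∑ k ∈ Finset.Icc 1 n, ‖a k‖ ≤ K * (n : ℝ) ^ r) :
    MemLp (dampedSum a σ) 2 := by
  refine ⟨(measurable_dampedSum a σ).aestronglyMeasurable, ?_⟩
  rw [eLpNorm_lt_top_iff_lintegral_rpow_enorm_lt_top (by norm_num) (by norm_num)]
  simpa using (lintegral_dampedSum_sq_le hr hK hσ ha).trans_lt ENNReal.ofReal_lt_top

theorem fourier_dampedSum (hr : 0 ≤ r) (hσ : r < σ)
    (ha : ∀ n : ℕ, ∑ k ∈ Finset.Icc 1 n, ‖a k‖ ≤ K * (n : ℝ) ^ r) (ξ : ℝ) :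
    LSeries a (σ + (2 * Real.pi * ξ : ℝ) * Complex.I) =
      (σ + (2 * Real.pi * ξ : ℝ) * Complex.I) * 𝓕 (dampedSum a σ) ξ := by
  set s : ℂ := σ + (2 * Real.pi * ξ : ℝ) * Complex.I with hs
  have hsre : s.re = σ := by simp [hs]
  have hO : (fun n : ℕ => ∑ k ∈ Finset.Icc 1 n, ‖a k‖) =O[Filter.atTop]
      fun n : ℕ => (n : ℝ) ^ r := by
    refine Asymptotics.IsBigO.of_bound K (.of_forall fun n => ?_)
    rw [Real.norm_of_nonneg (by positivity), Real.norm_of_nonneg (by positivity)]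
    exact ha n
  rw [LSeries_eq_mul_integral' a hr (by rw [hsre]; exact hσ) hO]
  congr 1
  rw [Real.fourier_real_eq_integral_exp_smul, ← Real.exp_zero, ← integral_comp_exp_Ioi,
    ← integral_Ici_eq_integral_Ioi, ← integral_indicator measurableSet_Ici]
  refine integral_congr_ae (.of_forall fun u => ?_)
  dsimp only
  rcases lt_or_ge u 0 with hu | hu
  · rw [indicator_of_notMem (by simpa using hu), dampedSum_of_neg _ _ hu, smul_zero]
  · rw [indicator_of_mem (by simpa using hu), dampedSum]
    have h1 : ((Real.exp u : ℝ) : ℂ) ^ (-(s + 1)) = Complex.exp (u * (-(s + 1))) := by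
      rw [Complex.cpow_def_of_ne_zero (by exact_mod_cast (Real.exp_pos u).ne'),
        ← Complex.ofReal_log (Real.exp_pos u).le, Real.log_exp]
    rw [h1, Complex.real_smul, smul_eq_mul, Complex.ofReal_exp, Complex.ofReal_exp,
      mul_left_comm, ← Complex.exp_add, ← mul_assoc, ← Complex.exp_add, mul_comm]
    congr 2
    rw [hs]; push_cast; ring
end

end

section

open MeasureTheory Set FourierTransform ArithmeticFunction

theorem sum_vonMangoldt_le (n : ℕ) : ∑ k ∈ Finset.Icc 1 n, Λ k ≤ 6 * n := by
  have h := Chebyshev.psi_le_const_mul_self (x := n) (by positivity)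
  rw [Chebyshev.psi, Nat.floor_natCast, ← Finset.Icc_add_one_left_eq_Ioc, zero_add] at h
  refine h.trans ?_
  gcongr
  have : Real.log 4 = 2 * Real.log 2 := by
    rw [show (4 : ℝ) = 2 ^ 2 by norm_num, Real.log_pow]; norm_num
  linarith [Real.log_two_lt_d9]

variable {f : ℕ → ℝ}

theorem sum_norm_mul_vonMangoldt_le (hb : ∀ n : ℕ, 0 < n → |f n| ≤ 1) {b : ℕ → ℂ}
    (h : ∀ k : ℕ, 0 < k → ‖b k‖ ≤ |f k| * Λ k) (n : ℕ) :
    ∑ k ∈ Finset.Icc 1 n, ‖b k‖ ≤ 6 * (n : ℝ) ^ (1 : ℝ) := by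
  rw [Real.rpow_one]
  refine (Finset.sum_le_sum fun k hk => ?_).trans (sum_vonMangoldt_le n)
  have hk0 : 0 < k := (Finset.mem_Icc.1 hk).1
  exact (h k hk0).trans (mul_le_of_le_one_left vonMangoldt_nonneg (hb k hk0))

theorem LSeries_mul_log (hf : IsComplMult f) (hb : ∀ n : ℕ, 0 < n → |f n| ≤ 1) {s : ℂ}
    (hs : 1 < s.re) :
    LSeries (fun n => (f n * Real.log n : ℝ)) s =
      LSeries (fun n => (f n : ℂ)) s * LSeries (fun n => (f n * Λ n : ℝ)) s := by
  have h2 : LSeriesSummable (fun n => ((f n * Λ n : ℝ) : ℂ)) s := by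
    refine LSeriesSummable_of_sum_norm_bigO (r := 1) ?_ zero_le_one hs
    refine Asymptotics.IsBigO.of_bound 6 (.of_forall fun n => ?_)
    rw [Real.norm_of_nonneg (by positivity), Real.norm_of_nonneg (by positivity)]
    refine sum_norm_mul_vonMangoldt_le hb (fun k _ => ?_) n
    rw [Complex.norm_real, norm_mul, Real.norm_eq_abs, Real.norm_of_nonneg vonMangoldt_nonneg]
  rw [← LSeries_convolution' (LSeriesSummable_of_abs_le_one hb hs) h2]
  refine LSeries_congr (fun {n} hn => ?_) s
  rw [LSeries.convolution_def]
  norm_cast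
  beta_reduce
  rw [Complex.ofReal_inj, ← vonMangoldt_sum, Finset.mul_sum,
    Nat.sum_divisorsAntidiagonal' (f := fun a b => f a * (f b * Λ b))]
  refine Finset.sum_congr rfl fun d hd => ?_
  have hd' := Nat.dvd_of_mem_divisors hd
  rw [← mul_assoc, ← hf.2 _ _ (Nat.div_pos (Nat.le_of_dvd (Nat.pos_of_ne_zero hn) hd')
    (Nat.pos_of_mem_divisors hd)) (Nat.pos_of_mem_divisors hd), Nat.div_mul_cancel hd']

theorem lintegral_LSeries_vonMangoldt_sq_le (hb : ∀ n : ℕ, 0 < n → |f n| ≤ 1) {α : ℝ} (hα : 0 < α)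
    (hα2 : α ≤ 2) (c : ℝ) :
    ∫⁻ ξ in Ico c (c + 1),
      ‖LSeries (fun n => (f n * Λ n : ℝ)) (1 + α + (2 * Real.pi * ξ : ℝ) * Complex.I)‖ₑ ^ 2 ≤
      ENNReal.ofReal (1000 / α) := by
  set b : ℕ → ℂ := fun n => (f n * Λ n : ℝ) * (n : ℂ) ^ (-((2 * Real.pi * c : ℝ) * Complex.I))
    with hbdef
  have hsum : ∀ n : ℕ, ∑ k ∈ Finset.Icc 1 n, ‖b k‖ ≤ 6 * (n : ℝ) ^ (1 : ℝ) := by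
    refine sum_norm_mul_vonMangoldt_le hb fun k hk => le_of_eq ?_
    rw [hbdef, norm_mul, Complex.norm_real, norm_mul, Real.norm_eq_abs,
      Real.norm_of_nonneg vonMangoldt_nonneg, Complex.norm_natCast_cpow_of_pos hk]
    simp
  have key : ∀ ξ ∈ Ico c (c + 1),
      ‖LSeries (fun n => ((f n * Λ n : ℝ) : ℂ))
        (1 + α + (2 * Real.pi * ξ : ℝ) * Complex.I)‖ₑ ^ 2 ≤
      ENNReal.ofReal 49 * ‖𝓕 (dampedSum b (1 + α)) (ξ - c)‖ₑ ^ 2 := by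
    intro ξ hξ
    have e1 : LSeries (fun n => ((f n * Λ n : ℝ) : ℂ))
        (1 + α + (2 * Real.pi * ξ : ℝ) * Complex.I) =
        LSeries b ((1 + α : ℝ) + (2 * Real.pi * (ξ - c) : ℝ) * Complex.I) := by
      refine tsum_congr fun n => ?_
      rcases eq_or_ne n 0 with rfl | hn
      · simp
      have hn' : (n : ℂ) ≠ 0 := by exact_mod_cast hn
      rw [LSeries.term_of_ne_zero hn, LSeries.term_of_ne_zero hn, hbdef]
      dsimp only
      rw [Complex.cpow_neg, div_eq_mul_inv, div_eq_mul_inv,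
        mul_assoc ((f n * Λ n : ℝ) : ℂ), ← mul_inv,
        ← Complex.cpow_add _ _ hn']
      congr 3
      push_cast; ring
    rw [e1, fourier_dampedSum zero_le_one (by linarith) hsum, enorm_mul, mul_pow]
    gcongr
    rw [← ofReal_norm, ← ENNReal.ofReal_pow (norm_nonneg _)]
    refine ENNReal.ofReal_le_ofReal ?_
    rw [Complex.sq_norm, Complex.normSq_add_mul_I]
    have h0 : 0 ≤ ξ - c := by linarith [hξ.1]
    have h1 : ξ - c ≤ 1 := by linarith [hξ.2]
    have h2 : 2 * Real.pi * (ξ - c) ≤ 6.3 := by nlinarith [Real.pi_lt_d2, Real.pi_pos]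
    have h3 : 0 ≤ 2 * Real.pi * (ξ - c) := by positivity
    nlinarith
  refine (setLIntegral_mono' measurableSet_Ico key).trans ?_
  refine (setLIntegral_le_lintegral _ _).trans ?_
  rw [lintegral_const_mul' _ _ ENNReal.ofReal_ne_top,
    lintegral_sub_right_eq_self (fun ξ => ‖𝓕 (dampedSum b (1 + α)) ξ‖ₑ ^ 2) c,
    lintegral_fourier_sq (integrable_dampedSum zero_le_one (by norm_num) (by linarith) hsum)
      (memLp_dampedSum zero_le_one (by norm_num) (by linarith) hsum)]
  refine (mul_le_mul_right
    (lintegral_dampedSum_sq_le zero_le_one (by norm_num) (by linarith) hsum) _).trans ?_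
  rw [← ENNReal.ofReal_mul (by norm_num)]
  refine ENNReal.ofReal_le_ofReal ?_
  rw [show (1 + α - 1) = α by ring, mul_div_assoc', div_le_div_iff₀ (by positivity) hα]
  nlinarith

end

section

open MeasureTheory Set FourierTransform ArithmeticFunction

theorem fourier_sub_mul_shift {T : ℝ → ℂ} (hT : Integrable T) (c : ℂ) (l ξ : ℝ) :
    𝓕 (fun u => T u - c * T (u - l)) ξ =
      (1 - c * Complex.exp (-(l * (2 * Real.pi * ξ : ℝ) * Complex.I))) * 𝓕 T ξ := by
  have i1 (S : ℝ → ℂ) (hS : Integrable S) :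
      Integrable fun u : ℝ => Complex.exp ((-2 * Real.pi * u * ξ : ℝ) * Complex.I) • S u := by
    refine hS.bdd_mul (c := 1) (Measurable.aestronglyMeasurable (by fun_prop))
      (.of_forall fun u => ?_)
    rw [Complex.norm_exp_ofReal_mul_I]
  simp only [Real.fourier_real_eq_integral_exp_smul]
  have i2 := i1 _ ((hT.comp_sub_right l).const_mul c)
  simp only [smul_sub]
  rw [integral_sub (i1 _ hT) i2, sub_mul, one_mul]
  congr 1
  rw [← integral_sub_right_eq_self (fun u : ℝ =>
    Complex.exp ((-2 * Real.pi * u * ξ : ℝ) * Complex.I) • T u) l, ← integral_const_mul]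
  refine integral_congr_ae (.of_forall fun u => ?_)
  simp only [smul_eq_mul]
  rw [mul_left_comm, mul_assoc c, ← mul_assoc (Complex.exp _) (Complex.exp _), ← Complex.exp_add]
  congr 3
  push_cast; ring

theorem summable_one_add_abs_int_rpow :
    Summable fun k : ℤ => ((1 + |(k : ℝ)|) / 3) ^ (-(3 / 2 : ℝ)) := by
  have h : Summable fun n : ℕ => ((1 + (n : ℝ)) / 3) ^ (-(3 / 2 : ℝ)) := by
    have := ((Real.summable_one_div_nat_add_rpow 1 (3 / 2)).2 (by norm_num)).mul_right
      ((3⁻¹ : ℝ) ^ (-(3 / 2 : ℝ)))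
    refine this.congr fun n => ?_
    rw [div_eq_mul_inv (1 + (n : ℝ)), Real.mul_rpow (by positivity) (by positivity), add_comm,
      abs_of_nonneg (by positivity), Real.rpow_neg (x := 1 + (n : ℝ)) (by positivity), one_div]
  exact Summable.of_nat_of_neg (by simpa using h) (by simpa using h)

theorem exists_lintegral_dampedSum_log_le : ∃ K : ℝ, 0 ≤ K ∧ ∀ (f : ℕ → ℝ), IsComplMult f →
    (∀ n : ℕ, 0 < n → |f n| ≤ 1) → ∀ α w : ℝ, 0 < α → α ≤ 2 → 1 ≤ w →
    ∫⁻ u, ‖dampedSum (fun n => (f n * Real.log n : ℝ)) (1 + α) u -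
      (w ^ (-α) : ℝ) * dampedSum (fun n => (f n * Real.log n : ℝ)) (1 + α) (u - Real.log w)‖ₑ ^ 2 ≤
      ENNReal.ofReal (K * √(Real.log (2 * w)) / (α ^ 2 * √α)) := by
  set c : ℤ → ℝ := fun k => ((1 + |(k : ℝ)|) / 3) ^ (-(3 / 2 : ℝ)) with hc
  have hc0 : ∀ k, 0 ≤ c k := fun k => by positivity
  have hcs : Summable c := summable_one_add_abs_int_rpow
  refine ⟨216000 * ∑' k, c k, mul_nonneg (by norm_num) (tsum_nonneg hc0), ?_⟩
  intro f hf hb α w hα hα2 hw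
  have hw0 : 0 < w := by linarith
  have hℓ : 0 < Real.log (2 * w) := Real.log_pos (by linarith)
  set a : ℕ → ℂ := fun n => (f n * Real.log n : ℝ) with ha
  set T := dampedSum a (1 + α) with hT
  have hsum : ∀ n : ℕ, ∑ k ∈ Finset.Icc 1 n, ‖a k‖ ≤ (2 / α) * (n : ℝ) ^ (1 + α / 2) := by
    intro n
    rcases Nat.eq_zero_or_pos n with rfl | hn
    · simp; positivity
    have hn' : (0 : ℝ) < n := by exact_mod_cast hn
    have h1 : ∀ k ∈ Finset.Icc 1 n, ‖a k‖ ≤ Real.log n := by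
      intro k hk
      have hk' := Finset.mem_Icc.1 hk
      have hk0 : (1 : ℝ) ≤ k := by exact_mod_cast hk'.1
      rw [ha, Complex.norm_real, norm_mul, Real.norm_eq_abs,
        Real.norm_of_nonneg (Real.log_nonneg hk0)]
      refine (mul_le_of_le_one_left (Real.log_nonneg hk0) (hb k hk'.1)).trans ?_
      exact Real.log_le_log (by linarith) (by exact_mod_cast hk'.2)
    refine (Finset.sum_le_card_nsmul _ _ _ h1).trans ?_
    have h2 := Real.log_le_rpow_div hn'.le (ε := α / 2) (by positivity)
    rw [Nat.card_Icc, Nat.add_sub_cancel, nsmul_eq_mul, Real.rpow_add hn', Real.rpow_one]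
    calc (n : ℝ) * Real.log n ≤ n * ((n : ℝ) ^ (α / 2) / (α / 2)) := by gcongr
      _ = _ := by field_simp
  have hr : 0 ≤ 1 + α / 2 := by positivity
  have hK : 0 ≤ 2 / α := by positivity
  have hlt : 1 + α / 2 < 1 + α := by linarith
  have hT1 : Integrable T := integrable_dampedSum hr hK hlt hsum
  have hT2 : MemLp T 2 := memLp_dampedSum hr hK hlt hsum
  set h : ℝ → ℂ := fun u => T u - (w ^ (-α) : ℝ) * T (u - Real.log w) with hh
  have h1 : Integrable h := hT1.sub ((hT1.comp_sub_right _).const_mul _)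
  have h2 : MemLp h 2 := hT2.sub ((hT2.comp_measurePreserving
    (measurePreserving_sub_right volume (Real.log w))).const_mul _)
  have hpt : ∀ k : ℤ, ∀ ξ ∈ Ico (k : ℝ) (k + 1), ‖𝓕 h ξ‖ₑ ^ 2 ≤
      ENNReal.ofReal (216 * √(Real.log (2 * w)) / (α * √α) * c k) *
      ‖LSeries (fun n => (f n * Λ n : ℝ))
        (1 + α + (2 * Real.pi * ξ : ℝ) * Complex.I)‖ₑ ^ 2 := by
    intro k ξ hξ
    set s : ℂ := 1 + α + (2 * Real.pi * ξ : ℝ) * Complex.I with hs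
    have hsre : s.re = 1 + α := by simp [hs]
    set m : ℝ := (1 + |(k : ℝ)|) / 3 with hm
    have hm0 : 0 < m := by positivity
    have hms : m ≤ ‖s‖ := by
      have e1 : 1 ≤ ‖s‖ := by
        have := Complex.re_le_norm s
        linarith
      have e2 : |ξ| ≤ ‖s‖ := by
        have := Complex.abs_im_le_norm s
        rw [show s.im = 2 * Real.pi * ξ by simp [hs], abs_mul, abs_of_pos (by positivity)] at this
        nlinarith [Real.pi_gt_three, abs_nonneg ξ]
      have e3 : |(k : ℝ)| ≤ 1 + |ξ| := by
        rw [abs_le]; constructor <;> cases abs_cases ξ <;> linarith [hξ.1, hξ.2]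
      rw [hm]; linarith
    have hs0 : 0 < ‖s‖ := hm0.trans_le hms
    have e4 : s * 𝓕 h ξ = (LSeries (fun n => (f n : ℂ)) s *
        (1 - (w : ℂ) ^ (-(α + (2 * Real.pi * ξ : ℝ) * Complex.I : ℂ)))) *
        LSeries (fun n => (f n * Λ n : ℝ)) s := by
      rw [hh, fourier_sub_mul_shift hT1]
      have e5 := fourier_dampedSum hr hlt hsum ξ
      rw [Complex.ofReal_add, Complex.ofReal_one, ← hs, ha,
        LSeries_mul_log hf hb (by rw [hsre]; linarith)] at e5
      have e6 : (w : ℂ) ^ (-(α + (2 * Real.pi * ξ : ℝ) * Complex.I : ℂ)) =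
          (w ^ (-α) : ℝ) * Complex.exp (-(Real.log w * (2 * Real.pi * ξ : ℝ) * Complex.I)) := by
        rw [neg_add, Complex.cpow_add _ _ (by exact_mod_cast hw0.ne'), Complex.ofReal_cpow hw0.le]
        congr 1
        · push_cast; rfl
        rw [Complex.cpow_def_of_ne_zero (by exact_mod_cast hw0.ne'), Complex.ofReal_log hw0.le]
        congr 1; ring
      rw [e6]
      linear_combination (-(1 - (w ^ (-α) : ℝ) *
        Complex.exp (-(Real.log w * (2 * Real.pi * ξ : ℝ) * Complex.I)))) * e5
    have e7 := norm_LSeries_mul_pow_four_le hf hb hα hα2 (2 * Real.pi * ξ) hw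
    rw [← hs] at e7
    set P := LSeries (fun n => (f n : ℂ)) s *
        (1 - (w : ℂ) ^ (-(α + (2 * Real.pi * ξ : ℝ) * Complex.I : ℂ))) with hP
    set G := LSeries (fun n => ((f n * Λ n : ℝ) : ℂ)) s with hG
    have e8 : ‖𝓕 h ξ‖ = ‖P‖ / ‖s‖ * ‖G‖ := by
      have := congrArg norm e4
      rw [norm_mul, norm_mul] at this
      field_simp
      linarith
    have e9 : (‖P‖ / ‖s‖) ^ 2 ≤ 216 * √(Real.log (2 * w)) / (α * √α) * c k := by
      have hck : c k ^ 2 = 1 / m ^ 3 := by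
        rw [hc, ← Real.rpow_natCast, ← Real.rpow_mul hm0.le]
        norm_num
      refine (pow_le_pow_iff_left₀ (by positivity)
        (mul_nonneg (by positivity) (hc0 k)) two_ne_zero).1 ?_
      have e11 : (216 * √(Real.log (2 * w)) / (α * √α)) ^ 2 = 46656 * Real.log (2 * w) / α ^ 3 := by
        rw [div_pow, mul_pow, mul_pow, Real.sq_sqrt hℓ.le, Real.sq_sqrt hα.le]
        norm_num; ring
      have : m ^ 3 ≤ ‖s‖ ^ 3 := by gcongr
      rw [mul_pow, hck, e11, ← pow_mul, div_pow, div_le_iff₀ (by positivity)]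
      refine e7.trans ?_
      rw [div_mul_div_comm, div_mul_eq_mul_div,
        div_le_div_iff₀ (by positivity) (by positivity)]
      have h9 : 0 ≤ 46656 * Real.log (2 * w) * ‖s‖ * α ^ 3 := by positivity
      linear_combination mul_le_mul_of_nonneg_left this h9
    have e10 : ‖𝓕 h ξ‖ₑ ^ 2 = ENNReal.ofReal ((‖P‖ / ‖s‖) ^ 2) * ‖G‖ₑ ^ 2 := by
      rw [← ofReal_norm, ← ofReal_norm, ← ENNReal.ofReal_pow (norm_nonneg _),
        ← ENNReal.ofReal_pow (norm_nonneg _), ← ENNReal.ofReal_mul (by positivity), e8, mul_pow]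
    rw [e10]
    gcongr
  rw [← lintegral_fourier_sq h1 h2, ← setLIntegral_univ, ← iUnion_Ico_intCast ℝ,
    lintegral_iUnion (fun _ => measurableSet_Ico) (pairwise_disjoint_Ico_intCast ℝ)]
  calc ∑' k : ℤ, ∫⁻ ξ in Ico (k : ℝ) (k + 1), ‖𝓕 h ξ‖ₑ ^ 2
      ≤ ∑' k : ℤ, ENNReal.ofReal
        (216 * √(Real.log (2 * w)) / (α * √α) * c k * (1000 / α)) := by
        refine ENNReal.tsum_le_tsum fun k => ?_
        refine (setLIntegral_mono' measurableSet_Ico (hpt k)).trans ?_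
        rw [lintegral_const_mul' _ _ ENNReal.ofReal_ne_top, ENNReal.ofReal_mul
          (mul_nonneg (by positivity) (hc0 k))]
        gcongr
        exact lintegral_LSeries_vonMangoldt_sq_le hb hα hα2 k
    _ = _ := by
        rw [← ENNReal.ofReal_tsum_of_nonneg, tsum_mul_right, tsum_mul_left]
        · congr 1
          field_simp
          ring
        · exact fun k => mul_nonneg (mul_nonneg (by positivity) (hc0 k)) (by positivity)
        · exact (hcs.mul_left _).mul_right _

end

section

open MeasureTheory Set

/-- The difference of the mean values of `f` at `t` and at `t / w`. -/
noncomputable def meanDiff (f : ℕ → ℝ) (w t : ℝ) : ℝ := meanValue f t - meanValue f (t / w)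

theorem sum_Icc_log (N : ℕ) : ∑ n ∈ Finset.Icc 1 N, Real.log n = Real.log N.factorial := by
  induction N with
  | zero => simp
  | succ N ih =>
    rw [Finset.sum_Icc_succ_top (by omega), ih, Nat.factorial_succ, Nat.cast_mul,
      Real.log_mul (by positivity) (by positivity), add_comm]

theorem sum_Icc_log_div_le {t : ℝ} (ht : 0 < t) :
    ∑ n ∈ Finset.Icc 1 ⌊t⌋₊, Real.log (t / n) ≤ t := by
  set N := ⌊t⌋₊ with hN
  rcases Nat.eq_zero_or_pos N with h | h
  · simp [h, ht.le]
  have hN0 : (0 : ℝ) < N := by exact_mod_cast h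
  have h1 : ∑ n ∈ Finset.Icc 1 N, Real.log (t / n) = N * Real.log t - Real.log (N.factorial) := by
    rw [Finset.sum_congr rfl fun n hn => Real.log_div ht.ne'
      (Nat.cast_ne_zero.2 (Nat.one_le_iff_ne_zero.1 (Finset.mem_Icc.1 hn).1)),
      Finset.sum_sub_distrib, sum_Icc_log]
    simp
  have h2 : N * Real.log N - Real.log N.factorial ≤ N := by
    have h := Real.pow_div_factorial_le_exp (N : ℝ) hN0.le N
    have h3 := Real.log_le_log (by positivity) h
    rwa [Real.log_exp, Real.log_div (by positivity) (by positivity), Real.log_pow] at h3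
  have h3 : N * (Real.log t - Real.log N) ≤ t - N := by
    rw [← Real.log_div ht.ne' hN0.ne']
    have h4 := Real.log_le_sub_one_of_pos (div_pos ht hN0)
    calc N * Real.log (t / N) ≤ N * (t / N - 1) := by gcongr
      _ = t - N := by field_simp
  rw [h1]; linarith

variable {f : ℕ → ℝ}

theorem abs_meanValue_le_one (hb : ∀ n : ℕ, 0 < n → |f n| ≤ 1) {t : ℝ} (ht : 0 < t) :
    |meanValue f t| ≤ 1 := by
  have h1 : |∑ n ∈ Finset.Icc 1 ⌊t⌋₊, f n| ≤ ⌊t⌋₊ := by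
    refine (Finset.abs_sum_le_sum_abs _ _).trans ((Finset.sum_le_card_nsmul _ _ 1 fun n hn =>
      hb n (Finset.mem_Icc.1 hn).1).trans (by simp))
  rw [meanValue, abs_mul, abs_of_pos (one_div_pos.2 ht), one_div_mul_eq_div, div_le_one ht]
  exact h1.trans (Nat.floor_le ht.le)

theorem abs_meanDiff_le_two (hb : ∀ n : ℕ, 0 < n → |f n| ≤ 1) {w t : ℝ} (hw : 1 ≤ w)
    (ht : 0 < t) : |meanDiff f w t| ≤ 2 := by
  have h1 := abs_meanValue_le_one hb ht
  have h2 := abs_meanValue_le_one hb (div_pos ht (by linarith : 0 < w))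
  exact (abs_sub _ _).trans (by linarith)

theorem measurable_meanValue (f : ℕ → ℝ) : Measurable (meanValue f) := by
  have h1 : Measurable fun u : ℝ => ∑ k ∈ Finset.Icc 1 ⌊u⌋₊, f k :=
    (measurable_from_nat (f := fun n => ∑ k ∈ Finset.Icc 1 n, f k)).comp Nat.measurable_floor
  exact Measurable.mul (by fun_prop) h1

theorem measurable_meanDiff (f : ℕ → ℝ) (w : ℝ) : Measurable (meanDiff f w) :=
  (measurable_meanValue f).sub ((measurable_meanValue f).comp (by fun_prop))

theorem abs_meanValue_mul_log_sub_le (hb : ∀ n : ℕ, 0 < n → |f n| ≤ 1) {t : ℝ} (ht : 0 < t) :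
    |meanValue f t * Real.log t -
      (∑ n ∈ Finset.Icc 1 ⌊t⌋₊, f n * Real.log n) / t| ≤ 1 := by
  have h1 : meanValue f t * Real.log t - (∑ n ∈ Finset.Icc 1 ⌊t⌋₊, f n * Real.log n) / t =
      (∑ n ∈ Finset.Icc 1 ⌊t⌋₊, f n * Real.log (t / n)) / t := by
    have : ∀ n ∈ Finset.Icc 1 ⌊t⌋₊,
        f n * Real.log (t / n) = f n * Real.log t - f n * Real.log n := by
      intro n hn
      rw [Real.log_div ht.ne'
        (Nat.cast_ne_zero.2 (Nat.one_le_iff_ne_zero.1 (Finset.mem_Icc.1 hn).1))]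
      ring
    rw [Finset.sum_congr rfl this, Finset.sum_sub_distrib, ← Finset.sum_mul, meanValue]
    ring
  rw [h1, abs_div, abs_of_pos ht, div_le_one ht]
  refine (Finset.abs_sum_le_sum_abs _ _).trans
    ((Finset.sum_le_sum fun n hn => ?_).trans (sum_Icc_log_div_le ht))
  have hn' := Finset.mem_Icc.1 hn
  have hn0 : (0 : ℝ) < n := by exact_mod_cast hn'.1
  have : 0 ≤ Real.log (t / n) := Real.log_nonneg
    ((one_le_div hn0).2 ((Nat.le_floor_iff ht.le).1 hn'.2))
  rw [abs_mul, abs_of_nonneg this]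
  exact mul_le_of_le_one_left this (hb n hn'.1)

theorem abs_meanDiff_mul_log_sub_le (hb : ∀ n : ℕ, 0 < n → |f n| ≤ 1) {w t : ℝ} (hw : 1 ≤ w)
    (ht : 0 < t) :
    |meanDiff f w t * Real.log t -
      ((∑ n ∈ Finset.Icc 1 ⌊t⌋₊, f n * Real.log n) -
        w * ∑ n ∈ Finset.Icc 1 ⌊t / w⌋₊, f n * Real.log n) / t| ≤ 4 * Real.log (2 * w) := by
  have hw0 : 0 < w := by linarith
  have htw : 0 < t / w := div_pos ht hw0
  have h1 := abs_meanValue_mul_log_sub_le hb ht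
  have h2 := abs_meanValue_mul_log_sub_le hb htw
  have h3 := abs_meanValue_le_one hb htw
  have h4 := Real.log_nonneg hw
  have h5 : |meanValue f (t / w) * Real.log w| ≤ Real.log w := by
    rw [abs_mul, abs_of_nonneg h4]; exact mul_le_of_le_one_left h4 h3
  have h6 := one_add_log_le hw
  rw [Real.log_div ht.ne' hw0.ne', div_div_eq_mul_div] at h2
  rw [meanDiff, sub_mul, sub_div, mul_comm w]
  rw [mul_sub] at h2
  rw [abs_le] at *
  constructor <;> linarith

end

section

open MeasureTheory Set

theorem norm_dampedSum_sub_eq (f : ℕ → ℝ) {w : ℝ} (hw : 0 < w) (α u : ℝ) :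
    ‖dampedSum (fun n => (f n * Real.log n : ℝ)) (1 + α) u -
      (w ^ (-α) : ℝ) * dampedSum (fun n => (f n * Real.log n : ℝ)) (1 + α) (u - Real.log w)‖ =
    Real.exp (-α * u) * |((∑ n ∈ Finset.Icc 1 ⌊Real.exp u⌋₊, f n * Real.log n) -
        w * ∑ n ∈ Finset.Icc 1 ⌊Real.exp u / w⌋₊, f n * Real.log n) / Real.exp u| := by
  have h1 : Real.exp (u - Real.log w) = Real.exp u / w := by rw [Real.exp_sub, Real.exp_log hw]
  have h2 : w ^ (-α) * Real.exp (-(1 + α) * (u - Real.log w)) =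
      Real.exp (-α * u) * w / Real.exp u := by
    rw [Real.rpow_def_of_pos hw, ← Real.exp_add]
    conv_rhs => rw [← Real.exp_log hw, ← Real.exp_add, ← Real.exp_sub]
    ring_nf
  have h3 : Real.exp (-(1 + α) * u) = Real.exp (-α * u) / Real.exp u := by
    rw [← Real.exp_sub]; ring_nf
  rw [dampedSum, dampedSum, h1, ← mul_assoc, ← Complex.ofReal_mul, h2, h3, ← Complex.ofReal_sum,
    ← Complex.ofReal_sum, ← Complex.ofReal_mul, ← Complex.ofReal_mul, ← Complex.ofReal_sub,
    Complex.norm_real, Real.norm_eq_abs, ← abs_of_pos (Real.exp_pos (-α * u)), ← abs_mul,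
    abs_of_pos (Real.exp_pos (-α * u))]
  congr 1; ring

theorem exists_integral_meanDiff_sq_le : ∃ K : ℝ, 0 ≤ K ∧ ∀ (f : ℕ → ℝ), IsComplMult f →
    (∀ n : ℕ, 0 < n → |f n| ≤ 1) → ∀ w U : ℝ, 1 ≤ w → Real.log (2 * w) ≤ U →
    ∫ u in U..2 * U, |meanDiff f w (Real.exp u)| ^ 2 ≤ K * (√(Real.log (2 * w)) * √U) := by
  obtain ⟨K, hK0, hK⟩ := exists_lintegral_dampedSum_log_le
  refine ⟨2 * Real.exp 4 * K + 32, by positivity, ?_⟩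
  intro f hf hb w U hw hU
  have hw0 : 0 < w := by linarith
  set ℓ := Real.log (2 * w) with hℓdef
  have hℓ2 : 1 / 2 < ℓ := by
    have h1 : Real.log 2 ≤ ℓ := Real.log_le_log (by norm_num) (by linarith)
    linarith [Real.log_two_gt_d9]
  have hU0 : 0 < U := by linarith
  have h_integrable : IntegrableOn (fun u => |meanDiff f w (Real.exp u)| ^ 2) (Ioc U (2 * U)) := by
    refine Measure.integrableOn_of_bounded (M := 4) measure_Ioc_lt_top.ne
      (((measurable_meanDiff f w).comp Real.measurable_exp).abs.pow_const 2).aestronglyMeasurable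
      (.of_forall fun u => ?_)
    rw [Real.norm_eq_abs, abs_pow, abs_abs]
    nlinarith [abs_meanDiff_le_two hb hw (Real.exp_pos u),
      abs_nonneg (meanDiff f w (Real.exp u))]
  set h : ℝ → ℂ := fun u => dampedSum (fun n => (f n * Real.log n : ℝ)) (1 + 1 / U) u -
      (w ^ (-(1 / U)) : ℝ) *
      dampedSum (fun n => (f n * Real.log n : ℝ)) (1 + 1 / U) (u - Real.log w) with hh
  have hpt : ∀ u ∈ Ioc U (2 * U), |meanDiff f w (Real.exp u)| ^ 2 ≤
      2 * Real.exp 4 / U ^ 2 * ‖h u‖ ^ 2 + 32 * ℓ ^ 2 / U ^ 2 := by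
    intro u hu
    have e1 := abs_meanDiff_mul_log_sub_le hb hw (Real.exp_pos u)
    have e2 := norm_dampedSum_sub_eq f hw0 (1 / U) u
    rw [Real.log_exp] at e1
    set Q := ((∑ n ∈ Finset.Icc 1 ⌊Real.exp u⌋₊, f n * Real.log n) -
        w * ∑ n ∈ Finset.Icc 1 ⌊Real.exp u / w⌋₊, f n * Real.log n) / Real.exp u
    have e3 : |Q| ≤ Real.exp 2 * ‖h u‖ := by
      rw [hh, e2, ← mul_assoc, ← Real.exp_add]
      refine le_mul_of_one_le_left (abs_nonneg _) (Real.one_le_exp ?_)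
      have : u / U ≤ 2 := (div_le_iff₀ hU0).2 hu.2
      have e : 2 + -(1 / U) * u = 2 - u / U := by ring
      linarith
    set φ := |meanDiff f w (Real.exp u)| with hφ
    have e4 : φ * u ≤ Real.exp 2 * ‖h u‖ + 4 * ℓ := by
      have h1 := abs_sub_abs_le_abs_sub (meanDiff f w (Real.exp u) * u) Q
      rw [abs_mul, abs_of_pos (hU0.trans hu.1)] at h1
      linarith
    have e5 : φ * U ≤ Real.exp 2 * ‖h u‖ + 4 * ℓ :=
      (mul_le_mul_of_nonneg_left hu.1.le (abs_nonneg _)).trans e4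
    have e6 : Real.exp 4 = Real.exp 2 ^ 2 := by rw [← Real.exp_nat_mul]; norm_num
    have e7 : (φ * U) ^ 2 ≤ 2 * (Real.exp 2 * ‖h u‖) ^ 2 + 2 * (4 * ℓ) ^ 2 := by
      have : (φ * U) ^ 2 ≤ (Real.exp 2 * ‖h u‖ + 4 * ℓ) ^ 2 := by gcongr
      nlinarith [sq_nonneg (Real.exp 2 * ‖h u‖ - 4 * ℓ)]
    rw [e6, div_mul_eq_mul_div, ← add_div, le_div_iff₀ (by positivity)]
    nlinarith
  have hα := hK f hf hb (1 / U) w (by positivity) ((div_le_iff₀ hU0).2 (by linarith)) hw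
  rw [intervalIntegral.integral_of_le (by linarith)]
  refine (ENNReal.ofReal_le_ofReal_iff (by positivity)).1 ?_
  rw [ofReal_integral_eq_lintegral_ofReal h_integrable (.of_forall fun u => by positivity)]
  calc ∫⁻ u in Ioc U (2 * U), ENNReal.ofReal (|meanDiff f w (Real.exp u)| ^ 2)
      ≤ ∫⁻ u in Ioc U (2 * U), (ENNReal.ofReal (2 * Real.exp 4 / U ^ 2) * ‖h u‖ₑ ^ 2 +
          ENNReal.ofReal (32 * ℓ ^ 2 / U ^ 2)) := by
        refine setLIntegral_mono' measurableSet_Ioc fun u hu => ?_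
        rw [← ofReal_norm, ← ENNReal.ofReal_pow (norm_nonneg _),
          ← ENNReal.ofReal_mul (by positivity), ← ENNReal.ofReal_add (by positivity)
          (by positivity)]
        exact ENNReal.ofReal_le_ofReal (hpt u hu)
    _ ≤ ENNReal.ofReal (2 * Real.exp 4 / U ^ 2) * ENNReal.ofReal (K * √ℓ / ((1 / U) ^ 2 * √(1 / U)))
          + ENNReal.ofReal (32 * ℓ ^ 2 / U ^ 2) * ENNReal.ofReal U := by
        rw [lintegral_add_right _ measurable_const, setLIntegral_const, Real.volume_Ioc,
          lintegral_const_mul' _ _ ENNReal.ofReal_ne_top]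
        gcongr
        · exact (setLIntegral_le_lintegral _ _).trans hα
        · linarith
    _ ≤ _ := by
        rw [← ENNReal.ofReal_mul (by positivity), ← ENNReal.ofReal_mul (by positivity),
          ← ENNReal.ofReal_add (by positivity) (by positivity)]
        refine ENNReal.ofReal_le_ofReal ?_
        rw [add_mul]
        refine add_le_add (le_of_eq ?_) ?_
        · rw [Real.sqrt_div zero_le_one, Real.sqrt_one]
          have := Real.sqrt_pos.2 hU0
          field_simp
        · have e1 : ℓ = √ℓ * √ℓ := (Real.mul_self_sqrt (by linarith)).symm
          have e2 : √ℓ ≤ √U := Real.sqrt_le_sqrt hU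
          have e3 : ℓ ^ 2 ≤ √ℓ * √U * U := by
            calc ℓ ^ 2 = √ℓ * √ℓ * ℓ := by rw [← e1]; ring
              _ ≤ √ℓ * √U * U := by gcongr
          calc 32 * ℓ ^ 2 / U ^ 2 * U = 32 * ℓ ^ 2 / U := by field_simp
            _ ≤ 32 * (√ℓ * √U * U) / U := by gcongr
            _ = _ := by field_simp

end

section

open MeasureTheory Set

theorem intervalIntegrable_meanDiff {f : ℕ → ℝ} (hb : ∀ n : ℕ, 0 < n → |f n| ≤ 1) {w : ℝ}
    (hw : 1 ≤ w) (a b : ℝ) :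
    IntervalIntegrable (fun u => |meanDiff f w (Real.exp u)|) volume a b := by
  refine (intervalIntegrable_const (c := (2 : ℝ))).mono_fun
    ((measurable_meanDiff f w).comp Real.measurable_exp).abs.aestronglyMeasurable
    (.of_forall fun u => ?_)
  simp only [Real.norm_eq_abs, abs_abs, abs_two]
  exact abs_meanDiff_le_two hb hw (Real.exp_pos u)

theorem exists_integral_meanDiff_le : ∃ K : ℝ, 0 ≤ K ∧ ∀ (f : ℕ → ℝ), IsComplMult f →
    (∀ n : ℕ, 0 < n → |f n| ≤ 1) → ∀ w U : ℝ, 1 ≤ w → Real.log (2 * w) ≤ U →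
    ∫ u in (0 : ℝ)..U, |meanDiff f w (Real.exp u)| ≤
      K * (U ^ (3 / 4 : ℝ) * Real.log (2 * w) ^ (1 / 4 : ℝ)) := by
  obtain ⟨M, hM0, hM⟩ := exists_integral_meanDiff_sq_le
  refine ⟨M + 5, by positivity, ?_⟩
  intro f hf hb w U hw hU
  set ℓ := Real.log (2 * w) with hℓdef
  have hℓ : 0 < ℓ := Real.log_pos (by linarith)
  have h_integrable := intervalIntegrable_meanDiff hb hw
  have hpow : ∀ V : ℝ, 0 < V → √ℓ * √V * (V / ℓ) ^ (1 / 4 : ℝ) =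
      V ^ (3 / 4 : ℝ) * ℓ ^ (1 / 4 : ℝ) ∧ V * (V / ℓ) ^ (-(1 / 4 : ℝ)) =
      V ^ (3 / 4 : ℝ) * ℓ ^ (1 / 4 : ℝ) := by
    intro V hV
    rw [Real.sqrt_eq_rpow, Real.sqrt_eq_rpow, Real.div_rpow hV.le hℓ.le,
      Real.div_rpow hV.le hℓ.le, div_eq_mul_inv (V ^ _), div_eq_mul_inv (V ^ _),
      ← Real.rpow_neg hℓ.le, ← Real.rpow_neg hℓ.le]
    constructor
    · calc ℓ ^ (1 / 2 : ℝ) * V ^ (1 / 2 : ℝ) * (V ^ (1 / 4 : ℝ) * ℓ ^ (-(1 / 4) : ℝ))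
          = (V ^ (1 / 2 : ℝ) * V ^ (1 / 4 : ℝ)) * (ℓ ^ (1 / 2 : ℝ) * ℓ ^ (-(1 / 4) : ℝ)) := by ring
        _ = _ := by rw [← Real.rpow_add hV, ← Real.rpow_add hℓ]; norm_num
    · nth_rw 1 [← Real.rpow_one V]
      rw [← mul_assoc, ← Real.rpow_add hV]; norm_num
  have hblock : ∀ V : ℝ, ℓ ≤ V → ∫ u in V..2 * V, |meanDiff f w (Real.exp u)| ≤
      (M / 2 + 1 / 2) * (V ^ (3 / 4 : ℝ) * ℓ ^ (1 / 4 : ℝ)) := by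
    intro V hV
    have hV0 : 0 < V := hℓ.trans_le hV
    obtain ⟨p1, p2⟩ := hpow V hV0
    set r : ℝ := (V / ℓ) ^ (1 / 4 : ℝ) with hr
    have hr0 : 0 < r := by positivity
    rw [Real.rpow_neg (by positivity), ← hr] at p2
    have hsq : IntervalIntegrable (fun u => |meanDiff f w (Real.exp u)| ^ 2) volume V (2 * V) := by
      refine (intervalIntegrable_const (c := (4 : ℝ))).mono_fun
        (((measurable_meanDiff f w).comp Real.measurable_exp).abs.pow_const 2).aestronglyMeasurable
        (.of_forall fun u => ?_)
      simp only [Real.norm_eq_abs, abs_pow, abs_abs]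
      rw [abs_of_pos (by norm_num : (0 : ℝ) < 4)]
      nlinarith [abs_meanDiff_le_two hb hw (Real.exp_pos u),
        abs_nonneg (meanDiff f w (Real.exp u))]
    calc ∫ u in V..2 * V, |meanDiff f w (Real.exp u)|
        ≤ ∫ u in V..2 * V, (r / 2 * |meanDiff f w (Real.exp u)| ^ 2 + r⁻¹ / 2) := by
          refine intervalIntegral.integral_mono_on (by linarith) (h_integrable _ _)
            ((hsq.const_mul _).add intervalIntegrable_const) fun u _ => ?_
          set φ := |meanDiff f w (Real.exp u)|
          have : 0 ≤ r⁻¹ / 2 * (r * φ - 1) ^ 2 := by positivity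
          have e : r⁻¹ / 2 * (r * φ - 1) ^ 2 = r / 2 * φ ^ 2 + r⁻¹ / 2 - φ := by
            field_simp; ring
          linarith
      _ = r / 2 * (∫ u in V..2 * V, |meanDiff f w (Real.exp u)| ^ 2) + V * r⁻¹ / 2 := by
          rw [intervalIntegral.integral_add (hsq.const_mul _) intervalIntegrable_const,
            intervalIntegral.integral_const_mul, intervalIntegral.integral_const, smul_eq_mul]
          ring
      _ ≤ r / 2 * (M * (√ℓ * √V)) + V * r⁻¹ / 2 := by
          gcongr
          exact hM f hf hb w V hw hV
      _ = M / 2 * (√ℓ * √V * r) + V * r⁻¹ / 2 := by ring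
      _ = _ := by rw [p1, p2]; ring
  have key : ∀ n : ℕ, ∀ V : ℝ, ℓ ≤ V → V ≤ 2 ^ n * ℓ →
      ∫ u in (0 : ℝ)..V, |meanDiff f w (Real.exp u)| ≤
        (M + 5) * (V ^ (3 / 4 : ℝ) * ℓ ^ (1 / 4 : ℝ)) := by
    have small : ∀ V : ℝ, ℓ ≤ V → V ≤ 2 * ℓ → ∫ u in (0 : ℝ)..V, |meanDiff f w (Real.exp u)| ≤
        (M + 5) * (V ^ (3 / 4 : ℝ) * ℓ ^ (1 / 4 : ℝ)) := by
      intro V hV hV2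
      have hV0 : 0 < V := hℓ.trans_le hV
      have h1 : ∫ u in (0 : ℝ)..V, |meanDiff f w (Real.exp u)| ≤ ∫ u in (0 : ℝ)..V, (2 : ℝ) :=
        intervalIntegral.integral_mono_on hV0.le (h_integrable _ _) intervalIntegrable_const
          fun u _ => abs_meanDiff_le_two hb hw (Real.exp_pos u)
      rw [intervalIntegral.integral_const, smul_eq_mul, sub_zero] at h1
      have h2 : V ≤ 2 * (V ^ (3 / 4 : ℝ) * ℓ ^ (1 / 4 : ℝ)) := by
        have e : V = V ^ (3 / 4 : ℝ) * V ^ (1 / 4 : ℝ) := by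
          rw [← Real.rpow_add hV0]; norm_num
        have e2 : V ^ (1 / 4 : ℝ) ≤ 2 * ℓ ^ (1 / 4 : ℝ) := by
          calc V ^ (1 / 4 : ℝ) ≤ (2 * ℓ) ^ (1 / 4 : ℝ) := by gcongr
            _ = 2 ^ (1 / 4 : ℝ) * ℓ ^ (1 / 4 : ℝ) := Real.mul_rpow (by norm_num) hℓ.le
            _ ≤ 2 * ℓ ^ (1 / 4 : ℝ) := by
              gcongr
              nth_rw 2 [← Real.rpow_one 2]
              exact Real.rpow_le_rpow_of_exponent_le (by norm_num) (by norm_num)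
        calc V = V ^ (3 / 4 : ℝ) * V ^ (1 / 4 : ℝ) := e
          _ ≤ V ^ (3 / 4 : ℝ) * (2 * ℓ ^ (1 / 4 : ℝ)) := by gcongr
          _ = _ := by ring
      have h3 : 0 ≤ V ^ (3 / 4 : ℝ) * ℓ ^ (1 / 4 : ℝ) := by positivity
      nlinarith
    intro n
    induction n with
    | zero => exact fun V hV hV2 => small V hV (by linarith)
    | succ n ih =>
      intro V hV hV2
      rcases le_or_gt V (2 * ℓ) with h | h
      · exact small V hV h
      have hV0 : 0 < V := hℓ.trans_le hV
      have h1 := ih (V / 2) (by linarith) (by rw [pow_succ] at hV2; linarith)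
      have h2 := hblock (V / 2) (by linarith)
      rw [mul_div_cancel₀ V two_ne_zero] at h2
      rw [← intervalIntegral.integral_add_adjacent_intervals (h_integrable 0 (V / 2))
        (h_integrable (V / 2) V)]
      have h3 : (V / 2) ^ (3 / 4 : ℝ) ≤ 2 / 3 * V ^ (3 / 4 : ℝ) := by
        have e : (1 / 2 : ℝ) ^ (3 / 4 : ℝ) ≤ 2 / 3 := by
          refine (pow_le_pow_iff_left₀ (by positivity) (by norm_num) (n := 4) (by norm_num)).1 ?_
          rw [← Real.rpow_natCast, ← Real.rpow_mul (by norm_num)]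
          norm_num
        rw [div_eq_mul_one_div, Real.mul_rpow hV0.le (by norm_num), mul_comm]
        gcongr
      have h4 : (V / 2) ^ (3 / 4 : ℝ) * ℓ ^ (1 / 4 : ℝ) ≤
          2 / 3 * (V ^ (3 / 4 : ℝ) * ℓ ^ (1 / 4 : ℝ)) := by
        rw [← mul_assoc]; gcongr
      have h5 : 0 ≤ V ^ (3 / 4 : ℝ) * ℓ ^ (1 / 4 : ℝ) := by positivity
      nlinarith
  obtain ⟨n, hn⟩ := pow_unbounded_of_one_lt (U / ℓ) (one_lt_two)
  exact key n U hU ((div_le_iff₀ hℓ).1 hn.le)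

end

theorem exists_abs_sub_le_of_abs_succ_sub_le {u b : ℕ → ℝ} (hb : ∀ n, 0 ≤ b n)
    (h : ∀ n, |u (n + 1) - u n| ≤ b n - b (n + 1)) : ∃ l, ∀ n, |u n - l| ≤ b n := by
  have h1 : Antitone fun n => u n + b n :=
    antitone_nat_of_succ_le fun n => by linarith [(abs_le.1 (h n)).2]
  have h2 : Monotone fun n => u n - b n :=
    monotone_nat_of_le_succ fun n => by linarith [(abs_le.1 (h n)).1]
  have h3 : ∀ i j, u i - b i ≤ u j + b j := fun i j =>
    (h2 (le_max_left i j)).trans ((by linarith [hb (max i j)] :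
      u (max i j) - b (max i j) ≤ u (max i j) + b (max i j)).trans (h1 (le_max_right i j)))
  have hbdd : BddAbove (Set.range fun n => u n - b n) :=
    ⟨u 0 + b 0, by rintro _ ⟨n, rfl⟩; exact h3 n 0⟩
  refine ⟨⨆ n, (u n - b n), fun n => abs_le.2 ⟨?_, ?_⟩⟩
  · have : ⨆ n, (u n - b n) ≤ u n + b n := ciSup_le fun i => h3 i n
    linarith
  · have : u n - b n ≤ ⨆ n, (u n - b n) := le_ciSup hbdd n
    linarith

theorem abs_harmonic_sub_log_le {t : ℝ} (ht : 1 ≤ t) :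
    |(∑ m ∈ Finset.Icc 1 ⌊t⌋₊, (1 : ℝ) / m) - Real.log t - Real.eulerMascheroniConstant| ≤
      2 / t := by
  set N := ⌊t⌋₊ with hN
  have hN1 : 1 ≤ N := Nat.one_le_floor_iff t |>.2 ht
  have hN0 : (0 : ℝ) < N := by exact_mod_cast hN1
  have hN1' : (1 : ℝ) ≤ N := by exact_mod_cast hN1
  have h1 : (N : ℝ) ≤ t := Nat.floor_le (by linarith)
  have h2 : t < N + 1 := Nat.lt_floor_add_one t
  have h3 := (Real.eulerMascheroniSeq_lt_eulerMascheroniConstant N).le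
  have h4 := (Real.eulerMascheroniConstant_lt_eulerMascheroniSeq' N).le
  have h5 : ((harmonic N : ℚ) : ℝ) = ∑ m ∈ Finset.Icc 1 N, (1 : ℝ) / m := by
    rw [harmonic_eq_sum_Icc]; push_cast; simp
  rw [Real.eulerMascheroniSeq, h5] at h3
  rw [Real.eulerMascheroniSeq', if_neg (by omega), h5] at h4
  have h6 : Real.log N ≤ Real.log t := Real.log_le_log hN0 h1
  have h7 : Real.log t ≤ Real.log (N + 1) := Real.log_le_log (by linarith) h2.le
  have h8 : Real.log (N + 1) - Real.log N ≤ 2 / t := by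
    rw [← Real.log_div (by positivity) hN0.ne']
    refine (Real.log_le_sub_one_of_pos (by positivity)).trans ?_
    rw [show ((N : ℝ) + 1) / N - 1 = 1 / N by field_simp; ring,
      div_le_div_iff₀ hN0 (by linarith)]
    linarith
  rw [abs_le]; constructor <;> linarith

theorem exists_abs_sum_log_div_sub_le : ∃ c C : ℝ, 0 ≤ C ∧ ∀ t : ℝ, 1 ≤ t →
    |(∑ m ∈ Finset.Icc 1 ⌊t⌋₊, Real.log m / m) - Real.log t ^ 2 / 2 - c| ≤ C / √t := by
  have key : ∃ c : ℝ, ∀ n : ℕ, |((∑ m ∈ Finset.Icc 1 (n + 1), Real.log m / m) -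
      Real.log (n + 1 : ℕ) ^ 2 / 2) - c| ≤ 20 / √(n + 1 : ℕ) := by
    refine exists_abs_sub_le_of_abs_succ_sub_le (u := fun n : ℕ =>
      (∑ m ∈ Finset.Icc 1 (n + 1), Real.log m / m) - Real.log (n + 1 : ℕ) ^ 2 / 2)
      (b := fun n : ℕ => 20 / √(n + 1 : ℕ)) (fun n => by positivity) fun k => ?_
    rw [Finset.sum_Icc_succ_top (by omega)]
    set n : ℝ := ((k + 1 : ℕ) : ℝ) with hn
    have hn1 : 1 ≤ n := by rw [hn]; push_cast; linarith [(Nat.cast_nonneg k : (0 : ℝ) ≤ k)]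
    rw [show ((k + 1 + 1 : ℕ) : ℝ) = n + 1 by rw [hn]; push_cast; ring]
    have hn0 : 0 < n := by linarith
    set δ := Real.log (n + 1) - Real.log n with hδ
    have d1 : δ ≤ 1 / n := by
      rw [hδ, ← Real.log_div (by positivity) hn0.ne']
      refine (Real.log_le_sub_one_of_pos (by positivity)).trans (le_of_eq ?_)
      field_simp; ring
    have d2 : 1 / (n + 1) ≤ δ := by
      have := Real.log_le_sub_one_of_pos (x := n / (n + 1)) (by positivity)
      rw [Real.log_div hn0.ne' (by positivity)] at this
      have e : n / (n + 1) - 1 = -(1 / (n + 1)) := by field_simp; ring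
      linarith
    set s := √n with hs
    set s' := √(n + 1) with hs'
    have es : s ^ 2 = n := Real.sq_sqrt hn0.le
    have es' : s' ^ 2 = n + 1 := Real.sq_sqrt (by linarith)
    have s1 : 1 ≤ s := Real.one_le_sqrt.2 hn1
    have ss : s ≤ s' := Real.sqrt_le_sqrt (by linarith)
    have ss2 : s' ≤ 2 * s := by nlinarith
    have l0 : 0 ≤ Real.log (n + 1) := Real.log_nonneg (by linarith)
    have l1 : Real.log (n + 1) ≤ 2 * s' := by
      have := Real.log_le_rpow_div (x := n + 1) (by linarith) (ε := 1 / 2) (by norm_num)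
      rw [← Real.sqrt_eq_rpow, ← hs'] at this
      linarith
    have e1 : |Real.log (n + 1) / (n + 1) - δ * (Real.log (n + 1) - δ / 2)| ≤
        2 * s' * (1 / n - 1 / (n + 1)) + (1 / n) ^ 2 := by
      have d0 : 0 ≤ δ := le_trans (by positivity) d2
      have e2 : Real.log (n + 1) / (n + 1) - δ * (Real.log (n + 1) - δ / 2) =
          δ ^ 2 / 2 - Real.log (n + 1) * (δ - 1 / (n + 1)) := by ring
      have e3 : Real.log (n + 1) * (δ - 1 / (n + 1)) ≤ 2 * s' * (1 / n - 1 / (n + 1)) := by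
        gcongr
      have e4 : 0 ≤ Real.log (n + 1) * (δ - 1 / (n + 1)) :=
        mul_nonneg l0 (by linarith)
      have e5 : δ ^ 2 ≤ (1 / n) ^ 2 := by gcongr
      rw [e2, abs_le]; constructor <;> nlinarith [sq_nonneg δ]
    have e6 : 2 * s' * (1 / n - 1 / (n + 1)) + (1 / n) ^ 2 ≤ 20 / s - 20 / s' := by
      have h1 : 20 / s - 20 / s' = 20 / (s * s' * (s + s')) := by
        have : s' - s = 1 / (s + s') := by
          rw [eq_div_iff (by positivity)]; nlinarith
        have hs0 : s ≠ 0 := by positivity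
        have hs'0 : s' ≠ 0 := by positivity
        calc 20 / s - 20 / s' = 20 * (s' - s) / (s * s') := by field_simp
          _ = _ := by rw [this]; field_simp
      have h2 : 2 * s' * (1 / n - 1 / (n + 1)) = 2 / (s ^ 2 * s') := by
        rw [show 1 / n - 1 / (n + 1) = 1 / (n * (n + 1)) by field_simp; ring, ← es', ← es]
        field_simp
      have h3 : (1 / n) ^ 2 = 1 / (s ^ 2) ^ 2 := by rw [es]; simp
      have h4 : 2 / (s ^ 2 * s') ≤ 2 / (s ^ 2 * s) := by gcongr
      have h5 : 1 / (s ^ 2) ^ 2 ≤ 1 / (s ^ 2 * s) := by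
        gcongr; nlinarith
      have h6 : 20 / (s * (2 * s) * (s + 2 * s)) ≤ 20 / (s * s' * (s + s')) := by gcongr
      have h7 : 20 / (s * (2 * s) * (s + 2 * s)) = (20 / 6) * (1 / (s ^ 2 * s)) := by
        field_simp; norm_num
      have h8 : (2 : ℝ) / (s ^ 2 * s) = 2 * (1 / (s ^ 2 * s)) := by ring
      have h9 : 0 ≤ 1 / (s ^ 2 * s) := by positivity
      rw [h1, h2, h3]
      linarith
    refine le_trans (le_of_eq ?_) (e1.trans e6)
    congr 1
    rw [hδ]; ring
  obtain ⟨c, hc⟩ := key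
  refine ⟨c, 44, by norm_num, fun t ht => ?_⟩
  have hN1 : 1 ≤ ⌊t⌋₊ := Nat.one_le_floor_iff t |>.2 ht
  obtain ⟨n, hn⟩ : ∃ n, ⌊t⌋₊ = n + 1 := ⟨⌊t⌋₊ - 1, by omega⟩
  have h1 : ((n + 1 : ℕ) : ℝ) ≤ t := hn ▸ Nat.floor_le (by linarith)
  have h2 : t < ((n + 1 : ℕ) : ℝ) + 1 := hn ▸ Nat.lt_floor_add_one t
  have hs1 : (1 : ℝ) ≤ (n + 1 : ℕ) := by exact_mod_cast hn ▸ hN1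
  have h3 := hc n
  rw [hn]
  set N : ℝ := ((n + 1 : ℕ) : ℝ) with hN
  have hN0 : 0 < N := by linarith
  have ht0 : 0 < t := by linarith
  have hst : √t ≤ 2 * √N := by
    rw [show (2 : ℝ) = √4 by rw [show (4 : ℝ) = 2 ^ 2 by norm_num]; simp,
      ← Real.sqrt_mul (by norm_num)]
    exact Real.sqrt_le_sqrt (by linarith)
  have h4 : 20 / √N ≤ 40 / √t := by
    rw [div_le_div_iff₀ (by positivity) (by positivity)]; linarith
  have l0 : 0 ≤ Real.log N := Real.log_nonneg hs1
  have l1 : Real.log N ≤ Real.log t := Real.log_le_log hN0 h1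
  have l2 : Real.log t ≤ 2 * √t := by
    have := Real.log_le_rpow_div (x := t) ht0.le (ε := 1 / 2) (by norm_num)
    rw [← Real.sqrt_eq_rpow] at this
    linarith
  have l3 : Real.log t - Real.log N ≤ 2 / t := by
    rw [← Real.log_div ht0.ne' hN0.ne']
    refine (Real.log_le_sub_one_of_pos (by positivity)).trans ?_
    rw [show t / N - 1 = (t - N) / N by field_simp, div_le_div_iff₀ hN0 ht0]
    nlinarith
  have l4 : Real.log t * (Real.log t - Real.log N) ≤ 2 * √t * (2 / t) := by
    gcongr
  have l5 : 2 * √t * (2 / t) = 4 / √t := by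
    nth_rewrite 2 [← Real.sq_sqrt ht0.le]
    field_simp; norm_num
  have l6 : (44 : ℝ) / √t = 40 / √t + 4 / √t := by ring
  have l7 : Real.log N ^ 2 ≤ Real.log t ^ 2 := by gcongr
  have l8 : Real.log t ^ 2 / 2 - Real.log N ^ 2 / 2 ≤
      Real.log t * (Real.log t - Real.log N) := by
    nlinarith [sq_nonneg (Real.log t - Real.log N)]
  rw [l6]
  obtain ⟨k1, k2⟩ := abs_le.1 h3
  rw [abs_le]; constructor <;> linarith

theorem antideriv_log_sq_bounds {s t : ℝ} (hs : 1 ≤ s) (hst : s ≤ t) :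
    let P : ℝ → ℝ := fun x => x * Real.log x ^ 2 - 2 * x * Real.log x + 2 * x
    (t - s) * Real.log s ^ 2 ≤ P t - P s ∧ P t - P s ≤ (t - s) * Real.log t ^ 2 := by
  intro P
  rcases hst.eq_or_lt with rfl | hlt
  · simp
  have hd : ∀ x ∈ Set.Icc s t, HasDerivAt P (Real.log x ^ 2) x := by
    intro x hx
    have hx0 : x ≠ 0 := by linarith [hx.1]
    have h1 := Real.hasDerivAt_log hx0
    have h := (((hasDerivAt_id x).mul (h1.pow 2)).sub
      (((hasDerivAt_id x).const_mul 2).mul h1)).add ((hasDerivAt_id x).const_mul 2)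
    refine h.congr_deriv ?_
    simp only [id, Pi.pow_apply]
    field_simp
    ring
  obtain ⟨ξ, hξ, h⟩ := exists_hasDerivAt_eq_slope P (fun x => Real.log x ^ 2) hlt
    (fun x hx => (hd x hx).continuousAt.continuousWithinAt)
    (fun x hx => hd x (Set.Ioo_subset_Icc_self hx))
  have hts : 0 < t - s := by linarith
  have e : P t - P s = (t - s) * Real.log ξ ^ 2 := by
    rw [h]; field_simp
  have l0 : 0 ≤ Real.log s := Real.log_nonneg hs
  have l1 : Real.log s ≤ Real.log ξ := Real.log_le_log (by linarith) hξ.1.le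
  have l2 : Real.log ξ ≤ Real.log t := Real.log_le_log (by linarith [hξ.1]) hξ.2.le
  have l3 := l0.trans l1
  rw [e]
  constructor <;> gcongr

theorem abs_sum_log_sq_sub_le {t : ℝ} (ht : 1 ≤ t) :
    |(∑ m ∈ Finset.Icc 1 ⌊t⌋₊, Real.log m ^ 2) -
      (t * Real.log t ^ 2 - 2 * t * Real.log t + 2 * t)| ≤ 2 + 2 * Real.log t ^ 2 := by
  set P : ℝ → ℝ := fun x => x * Real.log x ^ 2 - 2 * x * Real.log x + 2 * x with hP
  have key : ∀ n : ℕ, P (n + 1 : ℕ) - 2 ≤ ∑ m ∈ Finset.Icc 1 (n + 1), Real.log m ^ 2 ∧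
      ∑ m ∈ Finset.Icc 1 (n + 1), Real.log m ^ 2 ≤ P (n + 1 : ℕ) + Real.log (n + 1 : ℕ) ^ 2 := by
    intro n
    induction n with
    | zero => simp [hP]
    | succ n ih =>
      rw [Finset.sum_Icc_succ_top (by omega)]
      have h1 : (1 : ℝ) ≤ (n + 1 : ℕ) := by push_cast; linarith [(Nat.cast_nonneg n : (0 : ℝ) ≤ n)]
      have h := antideriv_log_sq_bounds (s := (n + 1 : ℕ)) (t := (n + 1 + 1 : ℕ)) h1
        (by push_cast; linarith)
      have e : ((n + 1 + 1 : ℕ) : ℝ) - (n + 1 : ℕ) = 1 := by push_cast; ring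
      rw [e, one_mul, one_mul] at h
      change _ ≤ P (n + 1 + 1 : ℕ) - P (n + 1 : ℕ) ∧ P (n + 1 + 1 : ℕ) - P (n + 1 : ℕ) ≤ _ at h
      constructor <;> linarith [ih.1, ih.2, h.1, h.2]
  have hN1 : 1 ≤ ⌊t⌋₊ := Nat.one_le_floor_iff t |>.2 ht
  obtain ⟨n, hn⟩ : ∃ n, ⌊t⌋₊ = n + 1 := ⟨⌊t⌋₊ - 1, by omega⟩
  have h1 : ((n + 1 : ℕ) : ℝ) ≤ t := hn ▸ Nat.floor_le (by linarith)
  have h2 : t < ((n + 1 : ℕ) : ℝ) + 1 := hn ▸ Nat.lt_floor_add_one t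
  have hs1 : (1 : ℝ) ≤ (n + 1 : ℕ) := by exact_mod_cast hn ▸ hN1
  have h3 := antideriv_log_sq_bounds hs1 h1
  change _ ≤ P t - P (n + 1 : ℕ) ∧ P t - P (n + 1 : ℕ) ≤ _ at h3
  change |_ - P t| ≤ _
  rw [hn]
  have l0 : 0 ≤ Real.log (n + 1 : ℕ) := Real.log_nonneg hs1
  have l1 : Real.log (n + 1 : ℕ) ≤ Real.log t := Real.log_le_log (by linarith) h1
  have l2 : Real.log (n + 1 : ℕ) ^ 2 ≤ Real.log t ^ 2 := by gcongr
  have l3 : (t - (n + 1 : ℕ)) * Real.log t ^ 2 ≤ 1 * Real.log t ^ 2 := by gcongr; linarith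
  have l4 : 0 ≤ (t - (n + 1 : ℕ)) * Real.log (n + 1 : ℕ) ^ 2 :=
    mul_nonneg (by linarith) (sq_nonneg _)
  obtain ⟨k1, k2⟩ := key n
  rw [abs_le]; constructor <;> linarith [h3.1, h3.2]

theorem log_le_two_mul_sqrt {t : ℝ} (ht : 0 ≤ t) : Real.log t ≤ 2 * √t := by
  have := Real.log_le_rpow_div (x := t) ht (ε := 1 / 2) (by norm_num)
  rw [← Real.sqrt_eq_rpow] at this
  linarith

theorem log_sq_le_sixteen_mul_sqrt {t : ℝ} (ht : 1 ≤ t) : Real.log t ^ 2 ≤ 16 * √t := by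
  have h := Real.log_le_rpow_div (x := t) (by linarith) (ε := 1 / 4) (by norm_num)
  have h0 := Real.log_nonneg ht
  have h2 : (t ^ (1 / 4 : ℝ)) ^ 2 = √t := by
    rw [Real.sqrt_eq_rpow, ← Real.rpow_natCast, ← Real.rpow_mul (by linarith)]; norm_num
  calc Real.log t ^ 2 ≤ (t ^ (1 / 4 : ℝ) / (1 / 4)) ^ 2 := by gcongr
    _ = 16 * (t ^ (1 / 4 : ℝ)) ^ 2 := by ring
    _ = _ := by rw [h2]

theorem exists_abs_sum_sub_sum_log_sq_le : ∃ a b C : ℝ, 0 ≤ C ∧ ∀ t : ℝ, 1 ≤ t →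
    |∑ m ∈ Finset.Icc 1 ⌊t⌋₊, (2 * (t / m) * Real.log (t / m) + a * (t / m) + b) -
      ∑ m ∈ Finset.Icc 1 ⌊t⌋₊, Real.log m ^ 2| ≤ C * √t := by
  obtain ⟨c, K, hK, h⟩ := exists_abs_sum_log_div_sub_le
  set γ := Real.eulerMascheroniConstant with hγ
  obtain ⟨a, ha⟩ : ∃ a : ℝ, a = -2 - 2 * γ := ⟨_, rfl⟩
  obtain ⟨b, hb⟩ : ∃ b : ℝ, b = 2 + 2 * c - a * γ := ⟨_, rfl⟩
  refine ⟨a, b, 42 + 2 * K + 2 * |a| + |b|, by positivity, fun t ht => ?_⟩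
  have ht0 : 0 < t := by linarith
  have h1 := abs_sum_log_sq_sub_le ht
  have h2 := h t ht
  have h3 := abs_harmonic_sub_log_le ht
  have hs1 : 1 ≤ √t := Real.one_le_sqrt.2 ht
  have hst : √t ^ 2 = t := Real.sq_sqrt ht0.le
  have l1 := log_le_two_mul_sqrt ht0.le
  have l2 := log_sq_le_sixteen_mul_sqrt ht
  have l0 := Real.log_nonneg ht
  have hf1 : (⌊t⌋₊ : ℝ) ≤ t := Nat.floor_le ht0.le
  have hf2 : t < ⌊t⌋₊ + 1 := Nat.lt_floor_add_one t
  have hsum : ∑ m ∈ Finset.Icc 1 ⌊t⌋₊, (2 * (t / m) * Real.log (t / m) + a * (t / m) + b) =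
      2 * t * Real.log t * (∑ m ∈ Finset.Icc 1 ⌊t⌋₊, (1 : ℝ) / m) -
      2 * t * (∑ m ∈ Finset.Icc 1 ⌊t⌋₊, Real.log m / m) +
      a * t * (∑ m ∈ Finset.Icc 1 ⌊t⌋₊, (1 : ℝ) / m) + b * ⌊t⌋₊ := by
    rw [Finset.mul_sum, Finset.mul_sum, Finset.mul_sum, ← Finset.sum_sub_distrib,
      ← Finset.sum_add_distrib]
    have : b * (⌊t⌋₊ : ℝ) = ∑ m ∈ Finset.Icc 1 ⌊t⌋₊, b := by simp [mul_comm]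
    rw [this, ← Finset.sum_add_distrib]
    refine Finset.sum_congr rfl fun m hm => ?_
    have hm0 : (m : ℝ) ≠ 0 := Nat.cast_ne_zero.2 (by have := (Finset.mem_Icc.1 hm).1; omega)
    rw [Real.log_div ht0.ne' hm0]
    ring
  rw [hsum]
  generalize (∑ m ∈ Finset.Icc 1 ⌊t⌋₊, (1 : ℝ) / m) = H at *
  generalize (∑ m ∈ Finset.Icc 1 ⌊t⌋₊, Real.log m / m) = M at *
  generalize (∑ m ∈ Finset.Icc 1 ⌊t⌋₊, Real.log m ^ 2) = S at *
  generalize (⌊t⌋₊ : ℝ) = N at *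
  set L := Real.log t
  have e : 2 * t * L * H - 2 * t * M + a * t * H + b * N - S =
      2 * L * (t * (H - L - γ)) - 2 * (t * (M - L ^ 2 / 2 - c)) + a * (t * (H - L - γ)) +
      b * (N - t) - (S - (t * L ^ 2 - 2 * t * L + 2 * t)) := by
    rw [hb, ha]; ring
  have q3 : |t * (H - L - γ)| ≤ 2 := by
    rw [abs_mul, abs_of_pos ht0]
    calc t * |H - L - γ| ≤ t * (2 / t) := by gcongr
      _ = 2 := by field_simp
  have q2 : |t * (M - L ^ 2 / 2 - c)| ≤ K * √t := by
    rw [abs_mul, abs_of_pos ht0]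
    calc t * |M - L ^ 2 / 2 - c| ≤ t * (K / √t) := by gcongr
      _ = K * √t := by nth_rewrite 1 [← hst]; field_simp
  have q1 : |N - t| ≤ 1 := abs_le.2 ⟨by linarith, by linarith⟩
  rw [e]
  have p1 : |2 * L * (t * (H - L - γ))| ≤ 8 * √t := by
    rw [abs_mul, abs_of_nonneg (by positivity)]
    calc 2 * L * |t * (H - L - γ)| ≤ 2 * (2 * √t) * 2 := by gcongr
      _ = 8 * √t := by ring
  have p2 : |2 * (t * (M - L ^ 2 / 2 - c))| ≤ 2 * K * √t := by
    rw [abs_mul, abs_of_pos two_pos]; linarith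
  have p3 : |a * (t * (H - L - γ))| ≤ 2 * |a| * √t := by
    rw [abs_mul]
    calc |a| * |t * (H - L - γ)| ≤ |a| * 2 := by gcongr
      _ = 2 * |a| * 1 := by ring
      _ ≤ _ := by gcongr
  have p4 : |b * (N - t)| ≤ |b| * √t := by
    rw [abs_mul]; gcongr; linarith
  have p5 : |S - (t * L ^ 2 - 2 * t * L + 2 * t)| ≤ 34 * √t := by linarith
  refine (abs_sub _ _).trans ?_
  have r1 := abs_add_le (2 * L * (t * (H - L - γ)) - 2 * (t * (M - L ^ 2 / 2 - c)) +
    a * (t * (H - L - γ))) (b * (N - t))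
  have r2 := abs_add_le (2 * L * (t * (H - L - γ)) - 2 * (t * (M - L ^ 2 / 2 - c)))
    (a * (t * (H - L - γ)))
  have r3 := abs_sub (2 * L * (t * (H - L - γ))) (2 * (t * (M - L ^ 2 / 2 - c)))
  linarith

section

open ArithmeticFunction

theorem sum_Icc_sum_Icc_div {M : Type*} [AddCommMonoid M] (G : ℕ → ℕ → M) (N : ℕ) :
    ∑ d ∈ Finset.Icc 1 N, ∑ m ∈ Finset.Icc 1 (N / d), G d m =
      ∑ n ∈ Finset.Icc 1 N, ∑ x ∈ n.divisorsAntidiagonal, G x.1 x.2 := by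
  rw [Finset.sum_sigma', Finset.sum_sigma']
  refine Finset.sum_bij' (fun x _ => ⟨x.1 * x.2, (x.1, x.2)⟩) (fun x _ => ⟨x.2.1, x.2.2⟩)
    ?_ ?_ ?_ ?_ ?_
  · rintro ⟨d, m⟩ h
    simp only [Finset.mem_sigma, Finset.mem_Icc, Nat.mem_divisorsAntidiagonal] at h ⊢
    have h1 : d * m ≤ N := (Nat.mul_le_mul_left d h.2.2).trans (Nat.mul_div_le N d)
    have h2 : 0 < d * m := Nat.mul_pos h.1.1 h.2.1
    exact ⟨⟨h2, h1⟩, trivial, h2.ne'⟩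
  · rintro ⟨n, d, m⟩ h
    simp only [Finset.mem_sigma, Finset.mem_Icc, Nat.mem_divisorsAntidiagonal] at h ⊢
    obtain ⟨⟨h1, h2⟩, rfl, h3⟩ := h
    have hd : 0 < d := Nat.pos_of_ne_zero fun h => h3 (by simp [h])
    have hm : 0 < m := Nat.pos_of_ne_zero fun h => h3 (by simp [h])
    refine ⟨⟨hd, le_trans (Nat.le_mul_of_pos_right d hm) h2⟩, hm, ?_⟩
    rw [Nat.le_div_iff_mul_le hd, mul_comm]
    exact h2
  · rintro ⟨d, m⟩ _; rfl
  · rintro ⟨n, d, m⟩ h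
    simp only [Finset.mem_sigma, Nat.mem_divisorsAntidiagonal] at h
    obtain ⟨-, rfl, -⟩ := h
    rfl
  · rintro ⟨d, m⟩ _; rfl

/-- Selberg's function `Λ log + Λ * Λ`. -/
noncomputable def selbergLambda : ArithmeticFunction ℝ :=
  pmul log vonMangoldt + vonMangoldt * vonMangoldt

theorem selbergLambda_nonneg (n : ℕ) : 0 ≤ selbergLambda n := by
  rw [selbergLambda, ArithmeticFunction.add_apply, pmul_apply, mul_apply, log_apply]
  exact add_nonneg (mul_nonneg (Real.log_natCast_nonneg n) vonMangoldt_nonneg)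
    (Finset.sum_nonneg fun _ _ => mul_nonneg vonMangoldt_nonneg vonMangoldt_nonneg)

theorem pmul_log_mul (g h : ArithmeticFunction ℝ) :
    pmul log (g * h) = pmul log g * h + g * pmul log h := by
  ext n
  rw [pmul_apply, ArithmeticFunction.add_apply, mul_apply, mul_apply, mul_apply, Finset.mul_sum,
    ← Finset.sum_add_distrib]
  refine Finset.sum_congr rfl fun x hx => ?_
  rw [pmul_apply, pmul_apply, log_apply, log_apply, log_apply]
  obtain ⟨rfl, h0⟩ := Nat.mem_divisorsAntidiagonal.1 hx
  rw [Nat.cast_mul, Real.log_mul (by rintro h; simp_all) (by rintro h; simp_all)]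
  ring

theorem selbergLambda_mul_zeta : selbergLambda * (zeta : ArithmeticFunction ℝ) = pmul log log := by
  have h := pmul_log_mul vonMangoldt (zeta : ArithmeticFunction ℝ)
  rw [vonMangoldt_mul_zeta, pmul_zeta] at h
  rw [h, selbergLambda, add_mul, mul_assoc, vonMangoldt_mul_zeta]

theorem moebius_mul_pmul_log_log :
    (moebius : ArithmeticFunction ℝ) * pmul log log = selbergLambda := by
  rw [← selbergLambda_mul_zeta, mul_comm, mul_assoc, coe_zeta_mul_coe_moebius, mul_one]

theorem sum_selbergLambda_eq (N : ℕ) : ∑ n ∈ Finset.Icc 1 N, selbergLambda n =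
    ∑ d ∈ Finset.Icc 1 N, (moebius d : ℝ) * ∑ m ∈ Finset.Icc 1 (N / d), Real.log m ^ 2 := by
  simp_rw [Finset.mul_sum]
  rw [sum_Icc_sum_Icc_div (fun d m => (moebius d : ℝ) * Real.log m ^ 2)]
  refine Finset.sum_congr rfl fun n _ => ?_
  rw [← moebius_mul_pmul_log_log, mul_apply]
  simp [sq, log_apply]

theorem sum_moebius_mul_sum (φ : ℝ → ℝ) {N : ℕ} (hN : 1 ≤ N) :
    ∑ d ∈ Finset.Icc 1 N, (moebius d : ℝ) * ∑ m ∈ Finset.Icc 1 (N / d), φ ((N : ℝ) / d / m) =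
      φ N := by
  simp_rw [Finset.mul_sum]
  rw [sum_Icc_sum_Icc_div (fun d m => (moebius d : ℝ) * φ ((N : ℝ) / d / m))]
  have h : ∀ n ∈ Finset.Icc 1 N, ∑ x ∈ n.divisorsAntidiagonal,
      (moebius x.1 : ℝ) * φ ((N : ℝ) / x.1 / x.2) = if n = 1 then φ N else 0 := by
    intro n _
    have h1 : ∑ x ∈ n.divisorsAntidiagonal, (moebius x.1 : ℝ) * φ ((N : ℝ) / x.1 / x.2) =
        ((moebius : ArithmeticFunction ℝ) * (zeta : ArithmeticFunction ℝ)) n * φ (N / n) := by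
      rw [mul_apply, Finset.sum_mul]
      refine Finset.sum_congr rfl fun x hx => ?_
      obtain ⟨rfl, h0⟩ := Nat.mem_divisorsAntidiagonal.1 hx
      have : x.2 ≠ 0 := by rintro h; simp_all
      simp [natCoe_apply, zeta_apply, this, div_div]
    rw [h1, coe_moebius_mul_coe_zeta, one_apply]
    split_ifs with h2
    · simp [h2]
    · simp
  rw [Finset.sum_congr rfl h]
  simp [hN]

theorem sum_one_div_sqrt_le (N : ℕ) : ∑ n ∈ Finset.Icc 1 N, 1 / √(n : ℝ) ≤ 2 * √N := by
  induction N with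
  | zero => simp
  | succ N ih =>
    rw [Finset.sum_Icc_succ_top (by omega)]
    have h0 : (0 : ℝ) ≤ N := by positivity
    have h1 : √(N : ℝ) ^ 2 = N := Real.sq_sqrt h0
    have h2 : √((N + 1 : ℕ) : ℝ) ^ 2 = N + 1 := by
      rw [Real.sq_sqrt (by positivity)]; push_cast; ring
    have h3 : 0 < √((N + 1 : ℕ) : ℝ) := Real.sqrt_pos.2 (by positivity)
    have h4 : 1 / √((N + 1 : ℕ) : ℝ) ≤ 2 * √((N + 1 : ℕ) : ℝ) - 2 * √(N : ℝ) := by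
      rw [div_le_iff₀ h3]
      nlinarith [sq_nonneg (√((N + 1 : ℕ) : ℝ) - √(N : ℝ))]
    linarith

theorem exists_abs_sum_selbergLambda_sub_le : ∃ C : ℝ, 0 ≤ C ∧ ∀ N : ℕ,
    |∑ n ∈ Finset.Icc 1 N, (selbergLambda n - 2 * Real.log n)| ≤ C * N := by
  obtain ⟨a, b, C, hC, h⟩ := exists_abs_sum_sub_sum_log_sq_le
  refine ⟨2 * C + 2 + |a| + |b|, by positivity, fun N => ?_⟩
  rcases Nat.eq_zero_or_pos N with rfl | hN
  · simp
  have hN1 : (1 : ℝ) ≤ N := by exact_mod_cast hN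
  have h1 := sum_moebius_mul_sum (fun u => 2 * u * Real.log u + a * u + b) hN
  beta_reduce at h1
  have h2 : |(2 * N * Real.log N + a * N + b) - ∑ n ∈ Finset.Icc 1 N, selbergLambda n| ≤
      2 * C * N := by
    rw [← h1, sum_selbergLambda_eq, ← Finset.sum_sub_distrib]
    calc _ ≤ ∑ d ∈ Finset.Icc 1 N, C * √N * (1 / √(d : ℝ)) := by
          refine (Finset.abs_sum_le_sum_abs _ _).trans (Finset.sum_le_sum fun d hd => ?_)
          obtain ⟨hd1, hd2⟩ := Finset.mem_Icc.1 hd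
          have hd0 : (0 : ℝ) < d := by exact_mod_cast hd1
          rw [← mul_sub, abs_mul]
          have h3 := h ((N : ℝ) / d) ((one_le_div hd0).2 (by exact_mod_cast hd2))
          rw [Nat.floor_div_natCast, Nat.floor_natCast, Real.sqrt_div' _ hd0.le] at h3
          have h4 : |((moebius d : ℤ) : ℝ)| ≤ 1 := by
            exact_mod_cast abs_moebius_le_one (n := d)
          calc _ ≤ 1 * (C * (√N / √d)) := by gcongr
            _ = _ := by ring
      _ = C * √N * ∑ d ∈ Finset.Icc 1 N, (1 / √(d : ℝ)) := by rw [Finset.mul_sum]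
      _ ≤ C * √N * (2 * √N) := by gcongr; exact sum_one_div_sqrt_le N
      _ = 2 * C * √N ^ 2 := by ring
      _ = 2 * C * N := by rw [Real.sq_sqrt (by positivity)]
  have h3 : N * Real.log N - N ≤ ∑ n ∈ Finset.Icc 1 N, Real.log n := by
    have := sum_Icc_log_div_le (t := N) (by linarith)
    rw [Nat.floor_natCast, Finset.sum_congr rfl fun n hn => Real.log_div (by linarith)
      (Nat.cast_ne_zero.2 (Nat.one_le_iff_ne_zero.1 (Finset.mem_Icc.1 hn).1)),
      Finset.sum_sub_distrib] at this
    simp only [Finset.sum_const, Nat.card_Icc, nsmul_eq_mul, Nat.add_sub_cancel] at this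
    linarith
  have h4 : ∑ n ∈ Finset.Icc 1 N, Real.log n ≤ N * Real.log N := by
    have := Finset.sum_le_card_nsmul (Finset.Icc 1 N) (fun n : ℕ => Real.log n) (Real.log N)
      fun n hn => Real.log_le_log (by exact_mod_cast (Finset.mem_Icc.1 hn).1)
        (by exact_mod_cast (Finset.mem_Icc.1 hn).2)
    simpa using this
  have h5 : |a * N| = |a| * N := by rw [abs_mul, abs_of_nonneg (by linarith : (0 : ℝ) ≤ N)]
  have h6 : |b| ≤ |b| * N := le_mul_of_one_le_right (abs_nonneg b) hN1
  rw [Finset.sum_sub_distrib, ← Finset.mul_sum]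
  obtain ⟨k1, k2⟩ := abs_le.1 h2
  have k3 := neg_abs_le (a * N)
  have k4 := le_abs_self (a * N)
  have k5 := neg_abs_le b
  have k6 := le_abs_self b
  rw [abs_le]; constructor <;> nlinarith

end

section

open ArithmeticFunction MeasureTheory

theorem sum_mul_log_sq_eq {f : ℕ → ℝ} (hf : IsComplMult f) (N : ℕ) :
    ∑ n ∈ Finset.Icc 1 N, f n * Real.log n ^ 2 =
      ∑ d ∈ Finset.Icc 1 N, f d * selbergLambda d * ∑ m ∈ Finset.Icc 1 (N / d), f m := by
  simp_rw [Finset.mul_sum]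
  rw [sum_Icc_sum_Icc_div (fun d m => f d * selbergLambda d * f m)]
  refine Finset.sum_congr rfl fun n _ => ?_
  have h1 : Real.log n ^ 2 = (selbergLambda * (zeta : ArithmeticFunction ℝ)) n := by
    rw [selbergLambda_mul_zeta, pmul_apply, log_apply, sq]
  rw [h1, mul_apply, Finset.mul_sum]
  refine Finset.sum_congr rfl fun x hx => ?_
  obtain ⟨rfl, h0⟩ := Nat.mem_divisorsAntidiagonal.1 hx
  have hx1 : x.1 ≠ 0 := by rintro h; simp_all
  have hx2 : x.2 ≠ 0 := by rintro h; simp_all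
  rw [hf.2 _ _ (Nat.pos_of_ne_zero hx1) (Nat.pos_of_ne_zero hx2)]
  simp [natCoe_apply, zeta_apply, hx2]
  ring

theorem meanValue_of_lt_one (f : ℕ → ℝ) {t : ℝ} (ht : t < 1) : meanValue f t = 0 := by
  simp [meanValue, Nat.floor_eq_zero.2 ht]

theorem sum_eq_mul_meanValue (f : ℕ → ℝ) {t : ℝ} (ht : 0 < t) :
    ∑ n ∈ Finset.Icc 1 ⌊t⌋₊, f n = t * meanValue f t := by
  rw [meanValue]; field_simp

theorem one_div_mul_sum_mul_log_sq_eq {f : ℕ → ℝ} (hf : IsComplMult f) {t : ℝ} (ht : 0 < t)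
    {N : ℕ} (hN : ⌊t⌋₊ ≤ N) :
    1 / t * ∑ n ∈ Finset.Icc 1 ⌊t⌋₊, f n * Real.log n ^ 2 =
      ∑ d ∈ Finset.Icc 1 N, f d * (selbergLambda d / d) * meanValue f (t / d) := by
  rw [sum_mul_log_sq_eq hf, Finset.mul_sum]
  rw [← Finset.sum_subset (Finset.Icc_subset_Icc_right hN)]
  · refine Finset.sum_congr rfl fun d hd => ?_
    have hd0 : (0 : ℝ) < d := by exact_mod_cast (Finset.mem_Icc.1 hd).1
    rw [← Nat.floor_div_natCast, sum_eq_mul_meanValue f (by positivity)]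
    field_simp
  · intro d hd hd'
    have h1 : 1 ≤ d := (Finset.mem_Icc.1 hd).1
    have hd0 : (0 : ℝ) < d := by exact_mod_cast h1
    have h2 : ⌊t⌋₊ < d := by
      by_contra! h
      exact hd' (Finset.mem_Icc.2 ⟨h1, h⟩)
    rw [meanValue_of_lt_one f ((div_lt_one hd0).2 ((Nat.floor_lt ht.le).1 h2)), mul_zero]

theorem abs_log_sq_mul_meanValue_sub_le {f : ℕ → ℝ} (hb : ∀ n : ℕ, 0 < n → |f n| ≤ 1) {x t : ℝ}
    (hx : 1 ≤ x) (ht : 0 < t) (htx : t ≤ x) :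
    |Real.log x ^ 2 * meanValue f t - 1 / t * ∑ n ∈ Finset.Icc 1 ⌊t⌋₊, f n * Real.log n ^ 2| ≤
      2 * Real.log x * (1 + Real.log (x / t)) := by
  have hL := Real.log_nonneg hx
  have e : Real.log x ^ 2 * meanValue f t -
      1 / t * ∑ n ∈ Finset.Icc 1 ⌊t⌋₊, f n * Real.log n ^ 2 =
      1 / t * ∑ n ∈ Finset.Icc 1 ⌊t⌋₊, f n * (Real.log x ^ 2 - Real.log n ^ 2) := by
    simp_rw [mul_sub]
    rw [Finset.sum_sub_distrib, ← Finset.sum_mul, meanValue]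
    ring
  rw [e, abs_mul, abs_of_pos (by positivity), one_div_mul_eq_div, div_le_iff₀ ht]
  have h2 : 0 ≤ Real.log (x / t) := Real.log_nonneg ((one_le_div ht).2 htx)
  calc _ ≤ ∑ n ∈ Finset.Icc 1 ⌊t⌋₊, 2 * Real.log x * (Real.log (t / n) + Real.log (x / t)) := by
        refine (Finset.abs_sum_le_sum_abs _ _).trans (Finset.sum_le_sum fun n hn => ?_)
        obtain ⟨hn1, hn2⟩ := Finset.mem_Icc.1 hn
        have hn0 : (0 : ℝ) < n := by exact_mod_cast hn1
        have hnt : (n : ℝ) ≤ t := (Nat.le_floor_iff ht.le).1 hn2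
        have l1 : 0 ≤ Real.log n := Real.log_natCast_nonneg n
        have l2 : Real.log n ≤ Real.log x := Real.log_le_log hn0 (hnt.trans htx)
        rw [Real.log_div ht.ne' hn0.ne', Real.log_div (by linarith) ht.ne', abs_mul]
        have h3 : 0 ≤ Real.log x ^ 2 - Real.log n ^ 2 := by nlinarith
        rw [abs_of_nonneg h3]
        calc _ ≤ 1 * (Real.log x ^ 2 - Real.log n ^ 2) := by gcongr; exact hb n hn1
          _ ≤ _ := by nlinarith
    _ = 2 * Real.log x * (∑ n ∈ Finset.Icc 1 ⌊t⌋₊, Real.log (t / n)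
          + ⌊t⌋₊ * Real.log (x / t)) := by
        rw [← Finset.mul_sum, Finset.sum_add_distrib]; simp
    _ ≤ 2 * Real.log x * (t + t * Real.log (x / t)) := by
        gcongr
        · exact sum_Icc_log_div_le ht
        · exact Nat.floor_le ht.le
    _ = _ := by ring

theorem abs_meanDiff_mul_log_sq_le {f : ℕ → ℝ} (hf : IsComplMult f)
    (hb : ∀ n : ℕ, 0 < n → |f n| ≤ 1) {w x : ℝ} (hw : 1 ≤ w) (hx : 1 ≤ x) :
    |meanDiff f w x| * Real.log x ^ 2 ≤
      ∑ d ∈ Finset.Icc 1 ⌊x⌋₊, selbergLambda d / d * |meanDiff f w (x / d)| +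
        4 * Real.log x * (1 + Real.log w) := by
  have hw0 : 0 < w := by linarith
  have hx0 : 0 < x := by linarith
  have hxw : 0 < x / w := by positivity
  have hle : x / w ≤ x := div_le_self hx0.le hw
  have h1 := abs_log_sq_mul_meanValue_sub_le hb hx hx0 le_rfl
  have h2 := abs_log_sq_mul_meanValue_sub_le hb hx hxw hle
  rw [one_div_mul_sum_mul_log_sq_eq hf hx0 le_rfl] at h1
  rw [one_div_mul_sum_mul_log_sq_eq hf hxw (Nat.floor_le_floor hle),
    show x / (x / w) = w by field_simp] at h2
  rw [div_self hx0.ne', Real.log_one] at h1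
  have h3 : |∑ d ∈ Finset.Icc 1 ⌊x⌋₊, f d * (selbergLambda d / d) * meanValue f (x / d) -
      ∑ d ∈ Finset.Icc 1 ⌊x⌋₊, f d * (selbergLambda d / d) * meanValue f (x / w / d)| ≤
      ∑ d ∈ Finset.Icc 1 ⌊x⌋₊, selbergLambda d / d * |meanDiff f w (x / d)| := by
    rw [← Finset.sum_sub_distrib]
    refine (Finset.abs_sum_le_sum_abs _ _).trans (Finset.sum_le_sum fun d hd => ?_)
    have h0 : 0 ≤ selbergLambda d / d := div_nonneg (selbergLambda_nonneg d) (by positivity)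
    rw [meanDiff, div_right_comm x (d : ℝ) w, ← mul_sub, abs_mul, abs_mul, abs_of_nonneg h0]
    refine mul_le_mul_of_nonneg_right ?_ (abs_nonneg _)
    exact mul_le_of_le_one_left h0 (hb d (Finset.mem_Icc.1 hd).1)
  have hL := Real.log_nonneg hx
  have hlw := Real.log_nonneg hw
  have h4 : |meanDiff f w x| * Real.log x ^ 2 =
      |Real.log x ^ 2 * meanValue f x - Real.log x ^ 2 * meanValue f (x / w)| := by
    rw [← mul_sub, abs_mul, abs_of_nonneg (sq_nonneg (Real.log x)), mul_comm, meanDiff]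
  have h5 : 0 ≤ Real.log x * Real.log w := mul_nonneg hL hlw
  rw [h4]
  obtain ⟨a1, a2⟩ := abs_le.1 h1
  obtain ⟨b1, b2⟩ := abs_le.1 h2
  obtain ⟨c1, c2⟩ := abs_le.1 h3
  rw [abs_le]; constructor <;> nlinarith

theorem abs_sum_mul_le_of_abs_sum_le {c ψ : ℕ → ℝ} {C : ℝ}
    (h : ∀ n : ℕ, |∑ d ∈ Finset.Icc 1 n, c d| ≤ C * n) {N : ℕ} (hN : ψ (N + 1) = 0) :
    |∑ d ∈ Finset.Icc 1 N, c d * ψ d| ≤ C * ∑ n ∈ Finset.Icc 1 N, n * |ψ n - ψ (n + 1)| := by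
  have key : ∀ N : ℕ, ∑ d ∈ Finset.Icc 1 N, c d * ψ d =
      (∑ d ∈ Finset.Icc 1 N, c d) * ψ (N + 1) +
        ∑ n ∈ Finset.Icc 1 N, (∑ d ∈ Finset.Icc 1 n, c d) * (ψ n - ψ (n + 1)) := by
    intro N
    induction N with
    | zero => simp
    | succ N ih =>
      rw [Finset.sum_Icc_succ_top (by omega), ih, Finset.sum_Icc_succ_top (by omega) (f := c),
        Finset.sum_Icc_succ_top (by omega) (f := fun n : ℕ =>
          (∑ d ∈ Finset.Icc 1 n, c d) * (ψ n - ψ (n + 1))),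
        Finset.sum_Icc_succ_top (by omega) (f := c)]
      ring
  rw [key, hN, mul_zero, zero_add, Finset.mul_sum]
  refine (Finset.abs_sum_le_sum_abs _ _).trans (Finset.sum_le_sum fun n _ => ?_)
  rw [abs_mul, ← mul_assoc]
  exact mul_le_mul_of_nonneg_right (h n) (abs_nonneg _)

/-- A bound for the oscillation of a mean value on `[y / (n + 1), y / n]`. -/
noncomputable def oscBound (y : ℝ) (n : ℕ) : ℝ :=
  n * ((⌊y / n⌋₊ : ℝ) - ⌊y / (n + 1 : ℕ)⌋₊) / y + 1 / (n + 1)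

theorem abs_meanValue_sub_le {f : ℕ → ℝ} (hb : ∀ n : ℕ, 0 < n → |f n| ≤ 1) {y s : ℝ} {n : ℕ}
    (hy : 0 < y) (hn : 1 ≤ n) (h1 : y / (n + 1 : ℕ) ≤ s) (h2 : s ≤ y / n) :
    |meanValue f (y / n) - meanValue f s| ≤ oscBound y n := by
  have hn0 : (0 : ℝ) < n := by exact_mod_cast hn
  have hs : 0 < s := lt_of_lt_of_le (by positivity) h1
  set t := y / n with ht
  have ht0 : 0 < t := by positivity
  have hfl : ⌊s⌋₊ ≤ ⌊t⌋₊ := Nat.floor_le_floor h2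
  have hfl' : ⌊y / (n + 1 : ℕ)⌋₊ ≤ ⌊s⌋₊ := Nat.floor_le_floor h1
  have e1 : ∑ k ∈ Finset.Icc 1 ⌊t⌋₊, f k =
      ∑ k ∈ Finset.Icc 1 ⌊s⌋₊, f k + ∑ k ∈ Finset.Ioc ⌊s⌋₊ ⌊t⌋₊, f k := by
    rw [← Finset.sum_sdiff (Finset.Icc_subset_Icc_right hfl), add_comm]
    congr 2
    ext k; simp only [Finset.mem_sdiff, Finset.mem_Icc, Finset.mem_Ioc]; omega
  have e2 : |∑ k ∈ Finset.Ioc ⌊s⌋₊ ⌊t⌋₊, f k| ≤ (⌊t⌋₊ : ℝ) - ⌊s⌋₊ := by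
    refine (Finset.abs_sum_le_sum_abs _ _).trans ((Finset.sum_le_card_nsmul _ _ 1 fun k hk =>
      hb k (by have := (Finset.mem_Ioc.1 hk).1; omega)).trans ?_)
    simp [Nat.cast_sub hfl]
  have e3 : meanValue f t - meanValue f s =
      (∑ k ∈ Finset.Ioc ⌊s⌋₊ ⌊t⌋₊, f k) / t - (1 - s / t) * meanValue f s := by
    rw [meanValue, e1, sum_eq_mul_meanValue f hs]; field_simp; ring
  have hst : s / t ≤ 1 := (div_le_one ht0).2 h2
  have hst' : 1 - s / t ≤ 1 / (n + 1) := by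
    have : (n : ℝ) / (n + 1) ≤ s / t := by
      rw [ht, div_div_eq_mul_div, div_le_div_iff₀ (by positivity) hy]
      rw [div_le_iff₀ (by positivity)] at h1
      push_cast at h1
      nlinarith
    have e : (1 : ℝ) / (n + 1) = 1 - n / (n + 1) := by field_simp; ring
    linarith
  have e4 : (⌊t⌋₊ - ⌊s⌋₊ : ℝ) / t ≤ n * ((⌊t⌋₊ : ℝ) - ⌊y / (n + 1 : ℕ)⌋₊) / y := by
    have h3 : (⌊y / (n + 1 : ℕ)⌋₊ : ℝ) ≤ ⌊s⌋₊ := by exact_mod_cast hfl'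
    calc (⌊t⌋₊ - ⌊s⌋₊ : ℝ) / t = n * ((⌊t⌋₊ : ℝ) - ⌊s⌋₊) / y := by rw [ht]; field_simp
      _ ≤ _ := by gcongr
  rw [e3]
  refine (abs_sub _ _).trans (add_le_add ?_ ?_)
  · rw [abs_div, abs_of_pos ht0]
    exact le_trans (by gcongr) e4
  · rw [abs_mul, abs_of_nonneg (by linarith)]
    exact (mul_le_of_le_one_right (by linarith) (abs_meanValue_le_one hb hs)).trans hst'

theorem sum_natCast_mul_sub_le {a : ℕ → ℝ} (ha : ∀ n, 0 ≤ a n) (N : ℕ) :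
    ∑ n ∈ Finset.Icc 1 N, n * (a n - a (n + 1)) ≤ ∑ n ∈ Finset.Icc 1 N, a n := by
  have key : ∑ n ∈ Finset.Icc 1 N, n * (a n - a (n + 1)) =
      ∑ n ∈ Finset.Icc 1 N, a n - N * a (N + 1) := by
    induction N with
    | zero => simp
    | succ N ih =>
      rw [Finset.sum_Icc_succ_top (by omega), Finset.sum_Icc_succ_top (by omega), ih]
      push_cast; ring
  have : 0 ≤ N * a (N + 1) := mul_nonneg (by positivity) (ha _)
  linarith

theorem sum_oscBound_le {y : ℝ} (hy : 0 < y) (N : ℕ) :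
    ∑ n ∈ Finset.Icc 1 N, oscBound y n ≤ 2 * ∑ n ∈ Finset.Icc 1 N, (1 : ℝ) / n := by
  simp only [oscBound]
  rw [Finset.sum_add_distrib, ← Finset.sum_div, two_mul]
  refine add_le_add ?_ (Finset.sum_le_sum fun n hn => ?_)
  · refine (div_le_div_of_nonneg_right
      (sum_natCast_mul_sub_le (a := fun n : ℕ => (⌊y / n⌋₊ : ℝ)) (fun n => by positivity) N)
      hy.le).trans ?_
    rw [div_le_iff₀ hy, Finset.sum_mul]
    refine Finset.sum_le_sum fun n _ => (Nat.floor_le (by positivity)).trans (le_of_eq (by ring))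
  · have hn0 : (0 : ℝ) < n := by exact_mod_cast (Finset.mem_Icc.1 hn).1
    gcongr; linarith

theorem sum_Icc_sub_succ (a : ℕ → ℝ) (N : ℕ) :
    ∑ n ∈ Finset.Icc 1 N, (a n - a (n + 1)) = a 1 - a (N + 1) := by
  induction N with
  | zero => simp
  | succ N ih => rw [Finset.sum_Icc_succ_top (by omega), ih]; ring

theorem sum_oscBound_div_le {y : ℝ} (hy : 0 < y) (N : ℕ) :
    ∑ n ∈ Finset.Icc 1 N, oscBound y n / n ≤ 2 := by
  have h1 := sum_Icc_sub_succ (fun n : ℕ => (⌊y / n⌋₊ : ℝ) / y + 1 / n) N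
  have h2 : ∑ n ∈ Finset.Icc 1 N, oscBound y n / n = ∑ n ∈ Finset.Icc 1 N,
      ((⌊y / n⌋₊ : ℝ) / y + 1 / n - ((⌊y / (n + 1 : ℕ)⌋₊ : ℝ) / y + 1 / (n + 1 : ℕ))) := by
    refine Finset.sum_congr rfl fun n hn => ?_
    have hn0 : (0 : ℝ) < n := by exact_mod_cast (Finset.mem_Icc.1 hn).1
    rw [oscBound]; push_cast; field_simp; ring
  rw [h2, h1]
  have h3 : (⌊y / (1 : ℕ)⌋₊ : ℝ) / y ≤ 1 := by
    rw [div_le_one hy, Nat.cast_one, div_one]; exact Nat.floor_le hy.le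
  have h4 : 0 ≤ (⌊y / (N + 1 : ℕ)⌋₊ : ℝ) / y + 1 / (N + 1 : ℕ) := by positivity
  norm_num at h3 h4 ⊢
  linarith

theorem abs_meanDiff_sub_le {f : ℕ → ℝ} (hb : ∀ n : ℕ, 0 < n → |f n| ≤ 1) {w x s : ℝ} {n : ℕ}
    (hw : 1 ≤ w) (hx : 0 < x) (hn : 1 ≤ n) (h1 : x / (n + 1 : ℕ) ≤ s) (h2 : s ≤ x / n) :
    abs (|meanDiff f w (x / n)| - |meanDiff f w s|) ≤ oscBound x n + oscBound (x / w) n := by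
  have hw0 : 0 < w := by linarith
  have k1 := abs_meanValue_sub_le hb hx hn h1 h2
  have k2 := abs_meanValue_sub_le hb (y := x / w) (s := s / w) (by positivity) hn
    (by rw [div_right_comm]; gcongr) (by rw [div_right_comm]; gcongr)
  refine (abs_abs_sub_abs_le_abs_sub _ _).trans ?_
  rw [meanDiff, meanDiff, div_right_comm x (n : ℝ) w,
    show ∀ a b c d : ℝ, a - b - (c - d) = a - c - (b - d) by intros; ring]
  exact (abs_sub _ _).trans (add_le_add k1 k2)

end

section

open ArithmeticFunction MeasureTheory

theorem sum_one_div_floor_le {x : ℝ} (hx : 1 ≤ x) :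
    ∑ n ∈ Finset.Icc 1 ⌊x⌋₊, (1 : ℝ) / n ≤ 1 + Real.log x := by
  have h := harmonic_floor_le_one_add_log x hx
  rw [harmonic_eq_sum_Icc] at h
  push_cast at h
  simpa using h

theorem meanDiff_of_lt_one (f : ℕ → ℝ) {w t : ℝ} (hw : 1 ≤ w) (ht0 : 0 ≤ t) (ht : t < 1) :
    meanDiff f w t = 0 := by
  rw [meanDiff, meanValue_of_lt_one f ht,
    meanValue_of_lt_one f (lt_of_le_of_lt (div_le_self ht0 hw) ht), sub_zero]

theorem exists_sum_selbergLambda_mul_le : ∃ C : ℝ, 0 ≤ C ∧ ∀ f : ℕ → ℝ,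
    (∀ n : ℕ, 0 < n → |f n| ≤ 1) → ∀ w x : ℝ, 1 ≤ w → 1 ≤ x →
      ∑ d ∈ Finset.Icc 1 ⌊x⌋₊, selbergLambda d / d * |meanDiff f w (x / d)| ≤
        2 * Real.log x * ∑ n ∈ Finset.Icc 1 ⌊x⌋₊, |meanDiff f w (x / n)| / n +
          C * (1 + Real.log x) := by
  obtain ⟨C, hC, h⟩ := exists_abs_sum_selbergLambda_sub_le
  refine ⟨C * 6, by positivity, fun f hb w x hw hx => ?_⟩
  have hx0 : 0 < x := by linarith
  have hw0 : 0 < w := by linarith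
  set N := ⌊x⌋₊ with hN
  set ψ : ℕ → ℝ := fun n => |meanDiff f w (x / n)| / n with hψ
  have hlt : x / (N + 1 : ℕ) < 1 := by
    rw [div_lt_one (by positivity)]; push_cast; exact Nat.lt_floor_add_one x
  have h1 := abs_sum_mul_le_of_abs_sum_le (ψ := ψ) h (N := N) (by
    simp only [hψ]; rw [meanDiff_of_lt_one f hw (by positivity) hlt]; simp)
  have h2 : ∑ n ∈ Finset.Icc 1 N, n * |ψ n - ψ (n + 1)| ≤
      ∑ n ∈ Finset.Icc 1 N, (oscBound x n + oscBound (x / w) n + 2 * (1 / n)) := by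
    refine Finset.sum_le_sum fun n hn => ?_
    have hn1 := (Finset.mem_Icc.1 hn).1
    have hn0 : (0 : ℝ) < n := by exact_mod_cast hn1
    have k1 := abs_meanDiff_sub_le hb hw hx0 hn1 le_rfl
      (by push_cast; gcongr; linarith)
    have k2 := abs_meanDiff_le_two hb hw (t := x / (n + 1 : ℕ)) (by positivity)
    have e : n * (ψ n - ψ (n + 1)) = (|meanDiff f w (x / n)| - |meanDiff f w (x / (n + 1 : ℕ))|) +
        |meanDiff f w (x / (n + 1 : ℕ))| * (1 / (n + 1 : ℕ)) := by
      simp only [hψ]; push_cast; field_simp; ring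
    rw [← abs_of_pos hn0, ← abs_mul, abs_of_pos hn0, e]
    refine (abs_add_le _ _).trans (add_le_add k1 ?_)
    rw [abs_of_nonneg (by positivity)]
    gcongr
    omega
  have h3 := sum_oscBound_le hx0 N
  have h4 := sum_oscBound_le (y := x / w) (by positivity) N
  have h5 := sum_one_div_floor_le hx
  rw [← hN] at h5
  rw [Finset.sum_add_distrib, Finset.sum_add_distrib, ← Finset.mul_sum] at h2
  have h6 : ∑ n ∈ Finset.Icc 1 N, n * |ψ n - ψ (n + 1)| ≤ 6 * (1 + Real.log x) := by linarith
  have h7 : C * ∑ n ∈ Finset.Icc 1 N, n * |ψ n - ψ (n + 1)| ≤ C * (6 * (1 + Real.log x)) := by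
    gcongr
  have h8 : ∑ d ∈ Finset.Icc 1 N, selbergLambda d / d * |meanDiff f w (x / d)| =
      ∑ d ∈ Finset.Icc 1 N, (selbergLambda d - 2 * Real.log d) * ψ d +
        ∑ d ∈ Finset.Icc 1 N, 2 * Real.log d * ψ d := by
    rw [← Finset.sum_add_distrib]
    exact Finset.sum_congr rfl fun d _ => by simp only [hψ]; ring
  have h9 : ∑ d ∈ Finset.Icc 1 N, 2 * Real.log d * ψ d ≤
      2 * Real.log x * ∑ n ∈ Finset.Icc 1 N, ψ n := by
    rw [Finset.mul_sum]
    refine Finset.sum_le_sum fun d hd => ?_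
    have hd0 : (0 : ℝ) < d := by exact_mod_cast (Finset.mem_Icc.1 hd).1
    have hdx : (d : ℝ) ≤ x := (Nat.le_floor_iff hx0.le).1 (Finset.mem_Icc.1 hd).2
    have : 0 ≤ ψ d := by positivity
    gcongr
  rw [h8]
  linarith [(abs_le.1 h1).2]

theorem sum_abs_meanDiff_div_le {f : ℕ → ℝ} (hb : ∀ n : ℕ, 0 < n → |f n| ≤ 1) {w x : ℝ}
    (hw : 1 ≤ w) (hx : 1 ≤ x) :
    ∑ n ∈ Finset.Icc 1 ⌊x⌋₊, |meanDiff f w (x / n)| / n ≤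
      (∫ u in (0 : ℝ)..Real.log x, |meanDiff f w (Real.exp u)|) + 6 := by
  have hx0 : 0 < x := by linarith
  have hw0 : 0 < w := by linarith
  set N := ⌊x⌋₊ with hN
  set p : ℕ → ℝ := fun n => Real.log (x / n) with hp
  have h_integrable := intervalIntegrable_meanDiff hb hw
  set φ : ℝ → ℝ := fun u => |meanDiff f w (Real.exp u)| with hφ
  have h1 : ∀ n ∈ Finset.Icc 1 N, |meanDiff f w (x / n)| / n ≤
      (∫ u in p (n + 1)..p n, φ u) + (oscBound x n / n + oscBound (x / w) n / n) +
        2 * (1 / n - 1 / (n + 1 : ℕ)) := by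
    intro n hn
    have hn1 := (Finset.mem_Icc.1 hn).1
    have hn0 : (0 : ℝ) < n := by exact_mod_cast hn1
    have hpp : p n - p (n + 1) = Real.log ((n + 1) / n) := by
      simp only [hp]
      rw [← Real.log_div (by positivity) (by positivity)]
      congr 1; push_cast; field_simp
    have u1 : p n - p (n + 1) ≤ 1 / n := by
      rw [hpp]
      refine (Real.log_le_sub_one_of_pos (by positivity)).trans (le_of_eq ?_)
      field_simp; ring
    have u2 : 1 / (n + 1 : ℕ) ≤ p n - p (n + 1) := by
      rw [hpp]
      have := Real.one_sub_inv_le_log_of_pos (x := ((n : ℝ) + 1) / n) (by positivity)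
      refine le_trans (le_of_eq ?_) this
      push_cast; field_simp; ring
    have u3 : p (n + 1) ≤ p n := by
      have : (0 : ℝ) ≤ 1 / (n + 1 : ℕ) := by positivity
      linarith
    set V := oscBound x n + oscBound (x / w) n with hV
    have h2 : ∀ u ∈ Set.Icc (p (n + 1)) (p n), |meanDiff f w (x / n)| - V ≤ φ u := by
      intro u hu
      have k := abs_meanDiff_sub_le hb hw hx0 hn1 (s := Real.exp u)
        ((Real.log_le_iff_le_exp (by positivity)).1 hu.1)
        ((Real.le_log_iff_exp_le (by positivity)).1 hu.2)
      have := (abs_le.1 k).2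
      simp only [hφ]
      linarith
    have h3 := intervalIntegral.integral_mono_on u3 (by simp) (h_integrable _ _) h2
    rw [intervalIntegral.integral_const, smul_eq_mul] at h3
    have hV0 : 0 ≤ V := le_trans (abs_nonneg _)
      (abs_meanDiff_sub_le hb hw hx0 hn1 (s := x / n) (by push_cast; gcongr; linarith) le_rfl)
    have h4 := abs_meanDiff_le_two hb hw (t := x / n) (by positivity)
    have h5 : (p n - p (n + 1)) * V ≤ 1 / n * V := by gcongr
    have h6 : (1 / n - (p n - p (n + 1))) * |meanDiff f w (x / n)| ≤
        (1 / n - 1 / (n + 1 : ℕ)) * 2 :=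
      mul_le_mul (by linarith) h4 (abs_nonneg _) (by linarith)
    have h7 : oscBound x n / n + oscBound (x / w) n / n = 1 / n * V := by rw [hV]; ring
    have h8 : |meanDiff f w (x / n)| / n = 1 / n * |meanDiff f w (x / n)| := by ring
    rw [h7, h8]
    linarith
  have h2 := Finset.sum_le_sum h1
  rw [Finset.sum_add_distrib, Finset.sum_add_distrib, Finset.sum_add_distrib, ← Finset.mul_sum,
    sum_Icc_sub_succ (fun n : ℕ => (1 : ℝ) / n)] at h2
  have h3 : ∑ n ∈ Finset.Icc 1 N, ∫ u in p (n + 1)..p n, φ u =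
      ∫ u in (0 : ℝ)..Real.log x, φ u := by
    have e1 : ∀ n, ∫ u in p (n + 1)..p n, φ u =
        (∫ u in (0 : ℝ)..p n, φ u) - ∫ u in (0 : ℝ)..p (n + 1), φ u := fun n =>
      (intervalIntegral.integral_interval_sub_left (h_integrable _ _) (h_integrable _ _)).symm
    have e2 : ∫ u in (0 : ℝ)..p (N + 1), φ u = 0 := by
      have hlt : x / (N + 1 : ℕ) < 1 := by
        rw [div_lt_one (by positivity)]; push_cast; exact Nat.lt_floor_add_one x
      have hp0 : p (N + 1) ≤ 0 := Real.log_nonpos (by positivity) hlt.le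
      rw [intervalIntegral.integral_symm, neg_eq_zero]
      rw [intervalIntegral.integral_congr_ae (g := fun _ => (0 : ℝ)),
        intervalIntegral.integral_zero]
      have hne : ∀ᵐ u : ℝ, u ≠ 0 := by simp [ae_iff]
      filter_upwards [hne] with u hu hu'
      rw [Set.uIoc_of_le hp0] at hu'
      have : Real.exp u < 1 := by
        simpa using lt_of_le_of_ne hu'.2 hu
      simp only [hφ]
      rw [meanDiff_of_lt_one f hw (Real.exp_pos u).le this, abs_zero]
    rw [Finset.sum_congr rfl fun n _ => e1 n,
      sum_Icc_sub_succ (fun n : ℕ => ∫ u in (0 : ℝ)..p n, φ u), e2, sub_zero]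
    simp [hp]
  have h4 := sum_oscBound_div_le hx0 N
  have h5 := sum_oscBound_div_le (y := x / w) (by positivity) N
  have h6 : (0 : ℝ) ≤ ((N : ℝ) + 1)⁻¹ := by positivity
  rw [h3] at h2
  norm_num at h2
  linarith

end

/-- Lipschitz estimate (3.2): `|F x - F (x/w)| ≤ C (log 2w / log x)^{1/4}`
for `1 ≤ w ≤ x/10` and `x ≥ x₀`. -/
theorem mean_value_lipschitz :
    ∃ C x₀ : ℝ, ∀ x : ℝ, x₀ ≤ x → ∀ w : ℝ, 1 ≤ w → w ≤ x / 10 →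
      ∀ f : ℕ → ℝ, IsComplMult f → (∀ n : ℕ, 0 < n → -1 ≤ f n ∧ f n ≤ 1) →
        |meanValue f x - meanValue f (x / w)|
          ≤ C * (Real.log (2 * w) / Real.log x) ^ ((1 : ℝ) / 4) := by
  obtain ⟨K, hK, hI⟩ := exists_integral_meanDiff_le
  obtain ⟨C, hC, hS⟩ := exists_sum_selbergLambda_mul_le
  refine ⟨2 * K + (16 + 2 * C) * 2, Real.exp 1, fun x hx w hw hwx f hf hf1 => ?_⟩
  have hb : ∀ n : ℕ, 0 < n → |f n| ≤ 1 := fun n hn => abs_le.2 (hf1 n hn)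
  have hx0 : 0 < x := (Real.exp_pos 1).trans_le hx
  have hx1 : 1 ≤ x := (Real.one_le_exp zero_le_one).trans hx
  have hL : 1 ≤ Real.log x := (Real.le_log_iff_exp_le hx0).2 hx
  have hl : Real.log (2 * w) ≤ Real.log x := Real.log_le_log (by linarith) (by linarith)
  have hlw := Real.log_nonneg hw
  have h1 := abs_meanDiff_mul_log_sq_le hf hb hw hx1
  have h2 := hS f hb w x hw hx1
  have h3 := sum_abs_meanDiff_div_le hb hw hx1
  have h4 := hI f hf hb w (Real.log x) hw hl
  have h5 := one_add_log_le hw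
  set L := Real.log x with hLdef
  set l := Real.log (2 * w) with hldef
  have hl0 : 0 < l := Real.log_pos (by linarith)
  have hL0 : 0 < L := by linarith
  have h6 : l ≤ L ^ (3 / 4 : ℝ) * l ^ (1 / 4 : ℝ) := by
    calc l = l ^ (3 / 4 : ℝ) * l ^ (1 / 4 : ℝ) := by
          rw [← Real.rpow_add hl0]; norm_num
      _ ≤ _ := by gcongr
  set E := L ^ (3 / 4 : ℝ) * l ^ (1 / 4 : ℝ) with hE
  have h7 : (l / L) ^ ((1 : ℝ) / 4) * L = E := by
    rw [hE, Real.div_rpow hl0.le hL0.le, show (3 / 4 : ℝ) = 1 - 1 / 4 by norm_num,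
      Real.rpow_sub hL0, Real.rpow_one]
    ring
  change |meanDiff f w x| ≤ _
  refine le_of_mul_le_mul_right ?_ hL0
  rw [mul_assoc, h7]
  refine le_of_mul_le_mul_left ?_ hL0
  have h8 : L * ∑ n ∈ Finset.Icc 1 ⌊x⌋₊, |meanDiff f w (x / n)| / n ≤ L * (K * E + 6) := by
    gcongr; linarith
  have h9 : L * Real.log w ≤ L * (2 * E - 1) := by gcongr; linarith
  have h10 : C * (1 + L) ≤ C * (2 * L) := by gcongr; linarith
  have h11 : C * L * (1 : ℝ) ≤ C * L * (2 * E) := by gcongr; linarith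
  have h12 : L * (1 : ℝ) ≤ L * (2 * E) := by gcongr; linarith
  nlinarith
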